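/- arXiv:1912.05486 — 3 statements merged into one kernel-verified Lean document; each statement's English description precedes it below -/
import Mathlib

section
/- Let G be a factor-critical graph given with an odd ear-decomposition P_0 + P_1 + ... + P_k, and let e = ab be an odd edge (with respect to this ear-decomposition) contained in a nontrivial ear. Then for every vertex v of G with ear(v) < ear(a) = ear(b), there exists a perfect matching of G − v containing the edge e. -/
variable {V : Type*}

/-- The list of edges of a walk given by its list of vertices. -/
def listEdges (l : List V) : List (Sym2 V) :=
  (l.zip l.tail).map fun p => s(p.1, p.2)

/-- The internal (non-endpoint) vertices of a path given by its list of vertices. -/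
def listInternal (l : List V) : List V := l.tail.dropLast

/-- `P 0, P 1, …, P k` is an ear-decomposition of `G`: `P 0` is a circuit
(a closed walk with at least `3` edges and pairwise distinct vertices), and every
`P i` with `i ≥ 1` is an ear: a path whose endpoints lie in
`V(P 0) ∪ ⋯ ∪ V(P (i-1))`, all internal vertices being new and pairwise distinct;
the ears are pairwise edge-disjoint and `G` is the union of `P 0, …, P k`. -/
structure IsEarDecomp (G : SimpleGraph V) (k : ℕ) (P : Fin (k + 1) → List V) : Prop where
  chain : ∀ i, (P i).Chain' G.Adj
  circuit_len : 4 ≤ (P 0).length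
  circuit_closed : (P 0).head? = (P 0).getLast?
  circuit_nodup : (P 0).dropLast.Nodup
  ear_len : ∀ i : Fin (k + 1), 1 ≤ i.1 → 2 ≤ (P i).length
  ear_first : ∀ i : Fin (k + 1), 1 ≤ i.1 →
    ∃ u, (P i).head? = some u ∧ ∃ j, j < i ∧ u ∈ P j
  ear_last : ∀ i : Fin (k + 1), 1 ≤ i.1 →
    ∃ u, (P i).getLast? = some u ∧ ∃ j, j < i ∧ u ∈ P j
  ear_internal_nodup : ∀ i : Fin (k + 1), 1 ≤ i.1 → (listInternal (P i)).Nodup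
  ear_internal_new : ∀ i : Fin (k + 1), 1 ≤ i.1 →
    ∀ v ∈ listInternal (P i), ∀ j, j < i → v ∉ P j
  edges_nodup : ∀ i, (listEdges (P i)).Nodup
  edges_disjoint : ∀ i j, i ≠ j → ∀ e ∈ listEdges (P i), e ∉ listEdges (P j)
  edges_cover : ∀ e ∈ G.edgeSet, ∃ i, e ∈ listEdges (P i)
  verts_cover : ∀ v : V, ∃ i, v ∈ P i

/-- An odd ear-decomposition: every ear (including the initial circuit)
has an odd number of edges. -/
def IsOddEarDecomp (G : SimpleGraph V) (k : ℕ) (P : Fin (k + 1) → List V) : Prop :=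
  IsEarDecomp G k P ∧ ∀ i, Odd ((P i).length - 1)

/-- `earOf k P v` is the index of the first ear in which the vertex `v` occurs. -/
noncomputable def earOf (k : ℕ) (P : Fin (k + 1) → List V) (v : V) : ℕ :=
  sInf {i : ℕ | ∃ hi : i < k + 1, v ∈ P ⟨i, hi⟩}

/-- The edge `ab` is *odd* with respect to the ear-decomposition `P`:
`ear a = ear b =: i` and, if `i ≥ 1`, then `a` is joined to an endpoint of `P i`
by an odd subpath of `P i` not containing `b` (if `a` sits at position `p` and `b`
at position `q` on `P i`, the subpath from `a` to the first endpoint has `p` edges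
and avoids `b` iff `p < q`; the one to the last endpoint has `length - 1 - p` edges
and avoids `b` iff `q < p`), and the same with the roles of `a` and `b` interchanged. -/
def IsOddEdge (k : ℕ) (P : Fin (k + 1) → List V) (a b : V) : Prop :=
  earOf k P a = earOf k P b ∧
  (1 ≤ earOf k P a →
    ∃ (hi : earOf k P a < k + 1)
      (p q : Fin (P ⟨earOf k P a, hi⟩).length),
      (P ⟨earOf k P a, hi⟩).get p = a ∧ (P ⟨earOf k P a, hi⟩).get q = b ∧
      ((p.1 < q.1 ∧ Odd p.1) ∨
        (q.1 < p.1 ∧ Odd ((P ⟨earOf k P a, hi⟩).length - 1 - p.1))) ∧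
      ((q.1 < p.1 ∧ Odd q.1) ∨
        (p.1 < q.1 ∧ Odd ((P ⟨earOf k P a, hi⟩).length - 1 - q.1))))

/-- A graph is factor-critical if deleting any vertex leaves a graph
with a perfect matching. -/
def IsFactorCritical (G : SimpleGraph V) : Prop :=
  ∀ v : V, ∃ M : G.Subgraph, M.verts = ({v} : Set V)ᶜ ∧ M.IsMatching

theorem injOn_disj {f : ℕ → V} {U S T : Set ℕ} (hf : Set.InjOn f U) (hS : S ⊆ U) (hT : T ⊆ U)
    (h : Disjoint S T) : Disjoint (f '' S) (f '' T) := by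
  rw [Set.disjoint_left]
  rintro _ ⟨x, hx, rfl⟩ ⟨y, hy, hxy⟩
  have := hf (hT hy) (hS hx) hxy
  subst this
  exact Set.disjoint_left.1 h hx hy

/-- `S` is perfectly matched in `G`. -/
def PM (G : SimpleGraph V) (S : Set V) : Prop :=
  ∃ M : G.Subgraph, M.IsMatching ∧ M.verts = S

/-- `S` is perfectly matched in `G`, using the edge `e`. -/
def PME (G : SimpleGraph V) (e : Sym2 V) (S : Set V) : Prop :=
  ∃ M : G.Subgraph, M.IsMatching ∧ M.verts = S ∧ e ∈ M.edgeSet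

theorem PME.union {G : SimpleGraph V} {e : Sym2 V} {S T : Set V} (hS : PME G e S) (hT : PM G T)
    (h : Disjoint S T) : PME G e (S ∪ T) := by
  obtain ⟨M, hM, rfl, he⟩ := hS
  obtain ⟨N, hN, rfl⟩ := hT
  refine ⟨M ⊔ N, hM.sup hN ?_, by simp, ?_⟩
  · rw [hM.support_eq_verts, hN.support_eq_verts]; exact h
  · simp [he]

theorem PM.union {G : SimpleGraph V} {S T : Set V} (hS : PM G S) (hT : PM G T)
    (h : Disjoint S T) : PM G (S ∪ T) := by
  obtain ⟨M, hM, rfl⟩ := hS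
  obtain ⟨N, hN, rfl⟩ := hT
  refine ⟨M ⊔ N, hM.sup hN ?_, by simp⟩
  rw [hM.support_eq_verts, hN.support_eq_verts]; exact h

theorem PME.pair {G : SimpleGraph V} {a b : V} (h : G.Adj a b) : PME G s(a, b) {a, b} :=
  ⟨G.subgraphOfAdj h, SimpleGraph.Subgraph.IsMatching.subgraphOfAdj h, by simp, by simp⟩

theorem PME.pm {G : SimpleGraph V} {e : Sym2 V} {S : Set V} (hS : PME G e S) : PM G S := by
  obtain ⟨M, hM, h, _⟩ := hS
  exact ⟨M, hM, h⟩

theorem PM.empty {G : SimpleGraph V} : PM G ∅ :=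
  ⟨⊥, by intro v hv; simp at hv, by simp⟩

theorem PM.seg {G : SimpleGraph V} (f : ℕ → V) (s n : ℕ)
    (hinj : Set.InjOn f (Set.Ico s (s + 2 * n)))
    (hadj : ∀ t, s ≤ t → t + 1 < s + 2 * n → G.Adj (f t) (f (t + 1))) :
    PM G (f '' Set.Ico s (s + 2 * n)) := by
  induction n with
  | zero => simpa using PM.empty
  | succ n ih =>
    have h1 := ih (hinj.mono (Set.Ico_subset_Ico_right (by omega)))
      (fun t h1 h2 => hadj t h1 (by omega))
    have h2 := (PME.pair (hadj (s + 2 * n) (by omega) (by omega))).pm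
    have h3 : f '' Set.Ico s (s + 2 * (n + 1)) =
        f '' Set.Ico s (s + 2 * n) ∪ {f (s + 2 * n), f (s + 2 * n + 1)} := by
      rw [← Set.image_pair, ← Set.image_union]
      congr 1
      ext x
      simp only [Set.mem_Ico, Set.mem_union, Set.mem_insert_iff, Set.mem_singleton_iff]
      omega
    rw [h3]
    refine h1.union h2 ?_
    rw [← Set.image_pair]
    refine injOn_disj hinj ?_ ?_ ?_
    · exact Set.Ico_subset_Ico_right (by omega)
    · intro x; simp only [Set.mem_Ico, Set.mem_insert_iff, Set.mem_singleton_iff]; omega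
    · rw [Set.disjoint_left]
      intro x; simp only [Set.mem_Ico, Set.mem_insert_iff, Set.mem_singleton_iff]; omega

theorem PM.seg' {G : SimpleGraph V} (f : ℕ → V) (s e : ℕ) (hse : s ≤ e) (hev : Even (e - s))
    (hinj : Set.InjOn f (Set.Ico s e))
    (hadj : ∀ t, s ≤ t → t + 1 < e → G.Adj (f t) (f (t + 1))) :
    PM G (f '' Set.Ico s e) := by
  obtain ⟨n, hn⟩ := hev
  obtain rfl : e = s + 2 * n := by omega
  exact PM.seg f s n hinj hadj

/-- Function form of an odd ear attached to `W`. -/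
structure EarF (G : SimpleGraph V) (W : Set V) (f : ℕ → V) (m : ℕ) : Prop where
  hm : Odd m
  first : f 0 ∈ W
  last : f m ∈ W
  new : ∀ t, 0 < t → t < m → f t ∉ W
  inj : Set.InjOn f (Set.Ico 1 m)
  adj : ∀ t, t < m → G.Adj (f t) (f (t + 1))

/-- `W` minus any of its vertices is perfectly matched. -/
def FC (G : SimpleGraph V) (W : Set V) : Prop := ∀ v ∈ W, PM G (W \ {v})

theorem EarF.disj {G : SimpleGraph V} {W : Set V} {f : ℕ → V} {m : ℕ} (h : EarF G W f m)
    {S : Set V} (hS : S ⊆ W) : Disjoint S (f '' Set.Ico 1 m) := by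
  rw [Set.disjoint_left]
  rintro x hx ⟨t, ht, rfl⟩
  exact h.new t ht.1 ht.2 (hS hx)

theorem EarF.internal {G : SimpleGraph V} {W : Set V} {f : ℕ → V} {m : ℕ} (h : EarF G W f m) :
    PM G (f '' Set.Ico 1 m) := by
  have := h.hm
  obtain ⟨n, rfl⟩ := this
  exact PM.seg' f 1 _ (by omega) ⟨n, by omega⟩ h.inj (fun t _ h2 => h.adj t (by omega))

theorem EarF.fc {G : SimpleGraph V} {W : Set V} {f : ℕ → V} {m : ℕ} (h : EarF G W f m)
    (hW : FC G W) : FC G (W ∪ f '' Set.Ico 1 m) := by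
  rintro v (hv | ⟨r, ⟨hr1, hr2⟩, rfl⟩)
  · have := (hW v hv).union h.internal (h.disj Set.sdiff_subset)
    convert this using 1
    have hd : v ∉ f '' Set.Ico 1 m := Set.disjoint_left.1 (h.disj subset_rfl) hv
    rw [Set.union_sdiff_distrib, Set.sdiff_singleton_eq_self hd]
  · have hm := h.hm
    have key : ∀ x y, 1 ≤ x → x < m → 1 ≤ y → y < m → f x = f y → x = y :=
      fun x y a b c d e => h.inj ⟨a, b⟩ ⟨c, d⟩ e
    have hnew := h.new
    have hf := h.first
    have hl := h.last
    rcases Nat.even_or_odd r with hr | hr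
    · -- match 0 .. r-1 and r+1 .. m-1
      have i1 : Set.InjOn f (Set.Ico 0 r) := by
        intro x hx y hy hxy
        simp only [Set.mem_Ico] at hx hy
        rcases Nat.eq_zero_or_pos x with rfl | hx0 <;> rcases Nat.eq_zero_or_pos y with rfl | hy0
        · rfl
        · exact absurd (hxy ▸ hf) (hnew y hy0 (by omega))
        · exact absurd (hxy ▸ hf) (hnew x hx0 (by omega))
        · exact key _ _ (by omega) (by omega) (by omega) (by omega) hxy
      have m1 := PM.seg' f 0 r (by omega) (by simpa using hr) i1
        (fun t _ h2 => h.adj t (by omega))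
      have m2 := PM.seg' f (r + 1) m (by omega) (by
        obtain ⟨a, ha⟩ := hm; obtain ⟨b, hb⟩ := hr; exact ⟨a - b, by omega⟩)
        (h.inj.mono (Set.Ico_subset_Ico_left (by omega))) (fun t _ h2 => h.adj t (by omega))
      have m3 := (m1.union (hW _ hf) (by
        rw [Set.disjoint_left]
        rintro x ⟨t, ht, rfl⟩ ⟨h1, h2⟩
        simp only [Set.mem_Ico] at ht
        rcases Nat.eq_zero_or_pos t with rfl | h0
        · exact h2 rfl
        · exact hnew t h0 (by omega) h1)).union m2 (by
        rw [Set.disjoint_left]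
        rintro x (⟨t, ht, rfl⟩ | ⟨h1, h2⟩) ⟨u, hu, hut⟩
        · simp only [Set.mem_Ico] at ht hu
          rcases Nat.eq_zero_or_pos t with rfl | h0
          · exact hnew u (by omega) (by omega) (hut ▸ hf)
          · have := key _ _ (by omega) (by omega) (by omega) (by omega) hut
            omega
        · simp only [Set.mem_Ico] at hu
          exact hnew u (by omega) (by omega) (hut ▸ h1))
      convert m3 using 1
      ext x
      constructor
      · rintro ⟨hx | ⟨t, ht, rfl⟩, hne⟩
        · by_cases hx0 : x = f 0
          · exact Or.inl (Or.inl ⟨0, ⟨by omega, by omega⟩, hx0.symm⟩)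
          · exact Or.inl (Or.inr ⟨hx, hx0⟩)
        · simp only [Set.mem_Ico] at ht
          have : t ≠ r := by rintro rfl; exact hne rfl
          rcases lt_or_gt_of_ne this with h1 | h1
          · exact Or.inl (Or.inl ⟨t, ⟨by omega, by omega⟩, rfl⟩)
          · exact Or.inr ⟨t, ⟨by omega, by omega⟩, rfl⟩
      · rintro ((⟨t, ht, rfl⟩ | ⟨h1, h2⟩) | ⟨t, ht, rfl⟩)
        · simp only [Set.mem_Ico] at ht
          rcases Nat.eq_zero_or_pos t with rfl | h0
          · exact ⟨Or.inl hf, fun h0 => hnew r (by omega) (by omega) (by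
              rw [← show f 0 = f r from h0]; exact hf)⟩
          · exact ⟨Or.inr ⟨t, ⟨by omega, by omega⟩, rfl⟩, fun h0 => by
              have := key _ _ (by omega) (by omega) (by omega) (by omega) h0
              omega⟩
        · exact ⟨Or.inl h1, fun h0 => hnew r (by omega) (by omega) (by
              rw [← show x = f r from h0]; exact h1)⟩
        · simp only [Set.mem_Ico] at ht
          exact ⟨Or.inr ⟨t, ⟨by omega, by omega⟩, rfl⟩, fun h0 => by
              have := key _ _ (by omega) (by omega) (by omega) (by omega) h0
              omega⟩
    · -- match 1 .. r-1 and r+1 .. m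
      have i1 : Set.InjOn f (Set.Ico (r + 1) (m + 1)) := by
        intro x hx y hy hxy
        simp only [Set.mem_Ico] at hx hy
        rcases eq_or_ne x m with hx1 | hx0 <;> rcases eq_or_ne y m with hy1 | hy0
        · omega
        · subst hx1
          exact absurd (hxy ▸ hl) (hnew y (by omega) (by omega))
        · subst hy1
          exact absurd (hxy ▸ hl) (hnew x (by omega) (by omega))
        · exact key _ _ (by omega) (by omega) (by omega) (by omega) hxy
      have m1 := PM.seg' f (r + 1) (m + 1) (by omega) (by
        obtain ⟨a, ha⟩ := hm; obtain ⟨b, hb⟩ := hr; exact ⟨a - b, by omega⟩) i1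
        (fun t _ h2 => h.adj t (by omega))
      have m2 := PM.seg' f 1 r (by omega) (by
        obtain ⟨b, hb⟩ := hr; exact ⟨b, by omega⟩)
        (h.inj.mono (Set.Ico_subset_Ico_right (by omega))) (fun t _ h2 => h.adj t (by omega))
      have m3 := (m1.union (hW _ hl) (by
        rw [Set.disjoint_left]
        rintro x ⟨t, ht, rfl⟩ ⟨h1, h2⟩
        simp only [Set.mem_Ico] at ht
        rcases eq_or_ne t m with rfl | h0
        · exact h2 rfl
        · exact hnew t (by omega) (by omega) h1)).union m2 (by
        rw [Set.disjoint_left]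
        rintro x (⟨t, ht, rfl⟩ | ⟨h1, h2⟩) ⟨u, hu, hut⟩
        · simp only [Set.mem_Ico] at ht hu
          rcases eq_or_ne t m with rfl | h0
          · exact hnew u (by omega) (by omega) (hut ▸ hl)
          · have := key _ _ (by omega) (by omega) (by omega) (by omega) hut
            omega
        · simp only [Set.mem_Ico] at hu
          exact hnew u (by omega) (by omega) (hut ▸ h1))
      convert m3 using 1
      ext x
      constructor
      · rintro ⟨hx | ⟨t, ht, rfl⟩, hne⟩
        · by_cases hx0 : x = f m
          · exact Or.inl (Or.inl ⟨m, ⟨by omega, by omega⟩, hx0.symm⟩)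
          · exact Or.inl (Or.inr ⟨hx, hx0⟩)
        · simp only [Set.mem_Ico] at ht
          have : t ≠ r := by rintro rfl; exact hne rfl
          rcases lt_or_gt_of_ne this with h1 | h1
          · exact Or.inr ⟨t, ⟨by omega, by omega⟩, rfl⟩
          · exact Or.inl (Or.inl ⟨t, ⟨by omega, by omega⟩, rfl⟩)
      · rintro ((⟨t, ht, rfl⟩ | ⟨h1, h2⟩) | ⟨t, ht, rfl⟩)
        · simp only [Set.mem_Ico] at ht
          rcases eq_or_ne t m with rfl | h0
          · exact ⟨Or.inl hl, fun h0 => hnew r (by omega) (by omega) (by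
              rw [← show f t = f r from h0]; exact hl)⟩
          · exact ⟨Or.inr ⟨t, ⟨by omega, by omega⟩, rfl⟩, fun h0 => by
              have := key _ _ (by omega) (by omega) (by omega) (by omega) h0
              omega⟩
        · exact ⟨Or.inl h1, fun h0 => hnew r (by omega) (by omega) (by
              rw [← show x = f r from h0]; exact h1)⟩
        · simp only [Set.mem_Ico] at ht
          exact ⟨Or.inr ⟨t, ⟨by omega, by omega⟩, rfl⟩, fun h0 => by
              have := key _ _ (by omega) (by omega) (by omega) (by omega) h0
              omega⟩

/-- Adding a nontrivial odd ear to a singleton: an odd circuit is factor-critical. -/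
theorem FC.singleton {G : SimpleGraph V} (x : V) : FC G {x} := by
  rintro v rfl
  simpa using PM.empty

/-- Vertices of the first `n` ears. -/
def WW (k : ℕ) (P : Fin (k + 1) → List V) (n : ℕ) : Set V := {x | ∃ j, j.1 < n ∧ x ∈ P j}

theorem ear_to_fun {G : SimpleGraph V} {k : ℕ} {P : Fin (k + 1) → List V}
    (hdec : IsOddEarDecomp G k P) (i : Fin (k + 1)) (W : Set V)
    (hW : W = if i.1 = 0 then {x | (P 0).head? = some x} else WW k P i.1) :
    ∃ f m, EarF G W f m ∧ (P i).length = m + 1 ∧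
      (∀ t (h : t < (P i).length), (P i)[t] = f t) ∧
      WW k P (i.1 + 1) = W ∪ f '' Set.Ico 1 m := by
  obtain ⟨hd, ho⟩ := hdec
  have hlen : 2 ≤ (P i).length := by
    rcases Nat.eq_zero_or_pos i.1 with h | h
    · have : i = 0 := Fin.ext h
      subst this
      have := hd.circuit_len
      omega
    · exact hd.ear_len i h
  obtain ⟨m, hm⟩ : ∃ m, (P i).length = m + 1 := ⟨(P i).length - 1, by omega⟩
  have x0 : V := (P i)[0]'(by omega)
  let f : ℕ → V := fun t => (P i).getD t x0
  have hf : ∀ t (h : t < (P i).length), (P i)[t] = f t := by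
    intro t h
    simp [f, h]
  have hhead : (P i).head? = some (f 0) := by
    rw [← hf 0 (by omega), List.head?_eq_getElem?, List.getElem?_eq_getElem]
  have hlast : (P i).getLast? = some (f m) := by
    rw [List.getLast?_eq_getElem?, show (P i).length - 1 = m by omega, ← hf m (by omega),
      List.getElem?_eq_getElem]
  have hmem : ∀ x, x ∈ P i ↔ ∃ t, t ≤ m ∧ f t = x := by
    intro x
    rw [List.mem_iff_getElem]
    constructor
    · rintro ⟨t, ht, rfl⟩
      exact ⟨t, by omega, (hf t ht).symm⟩
    · rintro ⟨t, ht, rfl⟩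
      exact ⟨t, by omega, hf t _⟩
  have hodd : Odd m := by simpa [hm] using ho i
  have hadj : ∀ t, t < m → G.Adj (f t) (f (t + 1)) := by
    intro t ht
    have := List.isChain_iff_getElem.1 (hd.chain i) t (by omega)
    rwa [hf, hf] at this
  refine ⟨f, m, ?_, hm, hf, ?_⟩
  · rcases Nat.eq_zero_or_pos i.1 with h | h
    · have : i = 0 := Fin.ext h
      subst this
      simp only [Fin.val_zero, if_true] at hW
      have hnd : Set.InjOn f (Set.Ico 0 m) := by
        intro x hx y hy hxy
        simp only [Set.mem_Ico] at hx hy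
        have := (List.nodup_iff_injective_getElem.1 hd.circuit_nodup)
        have h1 := @this ⟨x, by simp; omega⟩ ⟨y, by simp; omega⟩ (by
          simp only [List.getElem_dropLast]; rw [hf, hf]; exact hxy)
        simpa using h1
      refine ⟨hodd, ?_, ?_, ?_, ?_, hadj⟩
      · rw [hW]; exact hhead
      · rw [hW]; exact hd.circuit_closed.trans hlast
      · intro t h1 h2 h3
        rw [hW, Set.mem_ofPred_eq, hhead] at h3
        have := hnd (⟨by omega, by omega⟩) ⟨by omega, by omega⟩ (Option.some.inj h3)
        omega
      · exact hnd.mono (Set.Ico_subset_Ico_left (by omega))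
    · rw [if_neg (by omega)] at hW
      have hinter : ∀ t, 1 ≤ t → t < m → ∃ h : t - 1 < (listInternal (P i)).length,
          (listInternal (P i))[t - 1] = f t := by
        intro t h1 h2
        refine ⟨by simp [listInternal]; omega, ?_⟩
        rw [← hf t (by omega)]
        simp only [listInternal, List.getElem_dropLast, List.getElem_tail]
        congr 1
        omega
      refine ⟨hodd, ?_, ?_, ?_, ?_, hadj⟩
      · obtain ⟨u, hu, j, hj, huj⟩ := hd.ear_first i h
        rw [hhead] at hu
        rw [hW, Option.some.inj hu]
        exact ⟨j, hj, huj⟩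
      · obtain ⟨u, hu, j, hj, huj⟩ := hd.ear_last i h
        rw [hlast] at hu
        rw [hW, Option.some.inj hu]
        exact ⟨j, hj, huj⟩
      · intro t h1 h2 h3
        rw [hW] at h3
        obtain ⟨j, hj, h4⟩ := h3
        obtain ⟨h5, h6⟩ := hinter t h1 h2
        exact hd.ear_internal_new i h (f t) (h6 ▸ List.getElem_mem h5) j hj h4
      · intro x hx y hy hxy
        simp only [Set.mem_Ico] at hx hy
        obtain ⟨h1, h2⟩ := hinter x hx.1 hx.2
        obtain ⟨h3, h4⟩ := hinter y hy.1 hy.2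
        have := (hd.ear_internal_nodup i h).getElem_inj_iff.1 (h2.trans (hxy.trans h4.symm))
        omega
  · have hPi : ∀ x, f 0 ∈ W → f m ∈ W → (∃ t, t ≤ m ∧ f t = x) → x ∈ W ∪ f '' Set.Ico 1 m := by
      rintro x h0 h1 ⟨t, ht, rfl⟩
      rcases Nat.eq_zero_or_pos t with rfl | h2
      · exact Or.inl h0
      · rcases eq_or_ne t m with rfl | h3
        · exact Or.inl h1
        · exact Or.inr ⟨t, ⟨by omega, by omega⟩, rfl⟩
    rcases Nat.eq_zero_or_pos i.1 with h | h
    · have : i = 0 := Fin.ext h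
      subst this
      simp only [Fin.val_zero, if_true] at hW
      ext x
      constructor
      · rintro ⟨j, hj, hx⟩
        have : j = 0 := Fin.ext (by simp at hj ⊢; omega)
        subst this
        exact hPi x (by rw [hW]; exact hhead) (by rw [hW]; exact hd.circuit_closed.trans hlast)
          ((hmem x).1 hx)
      · rintro (hx | ⟨t, ht, rfl⟩)
        · rw [hW, Set.mem_ofPred_eq, hhead] at hx
          exact ⟨0, by simp, (hmem x).2 ⟨0, by omega, Option.some.inj hx⟩⟩
        · exact ⟨0, by simp, (hmem _).2 ⟨t, ht.2.le, rfl⟩⟩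
    · rw [if_neg (by omega)] at hW
      ext x
      constructor
      · rintro ⟨j, hj, hx⟩
        rcases eq_or_ne j i with rfl | hne
        · refine hPi x ?_ ?_ ((hmem x).1 hx)
          · obtain ⟨u, hu, j', hj', huj⟩ := hd.ear_first j h
            rw [hhead] at hu
            rw [hW, Option.some.inj hu]
            exact ⟨j', hj', huj⟩
          · obtain ⟨u, hu, j', hj', huj⟩ := hd.ear_last j h
            rw [hlast] at hu
            rw [hW, Option.some.inj hu]
            exact ⟨j', hj', huj⟩
        · have : j.1 ≠ i.1 := fun h => hne (Fin.ext h)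
          rw [hW]
          exact Or.inl ⟨j, by omega, hx⟩
      · rintro (hx | ⟨t, ht, rfl⟩)
        · rw [hW] at hx
          obtain ⟨j, hj, hx⟩ := hx
          exact ⟨j, by omega, hx⟩
        · exact ⟨i, by simp, (hmem _).2 ⟨t, ht.2.le, rfl⟩⟩

theorem WW_fc {G : SimpleGraph V} {k : ℕ} {P : Fin (k + 1) → List V}
    (hdec : IsOddEarDecomp G k P) (n : ℕ) (hn : n < k + 1) : FC G (WW k P (n + 1)) := by
  induction n with
  | zero =>
    obtain ⟨f, m, h, -, -, h2⟩ := ear_to_fun hdec 0 _ rfl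
    simp only [Fin.val_zero, if_true] at h h2
    rw [h2]
    refine h.fc ?_
    have h0 := h.first
    have : {x | (P 0).head? = some x} = {f 0} := by
      ext x
      rw [Set.mem_ofPred_eq] at h0 ⊢
      rw [h0]
      simp [eq_comm]
    rw [this]
    exact FC.singleton _
  | succ n ih =>
    obtain ⟨f, m, h, -, -, h2⟩ := ear_to_fun hdec ⟨n + 1, hn⟩ _ rfl
    simp only [Nat.add_eq_zero_iff, one_ne_zero, and_false, if_false] at h h2
    rw [h2]
    exact h.fc (ih (by omega))

theorem stmt_0 {V : Type*} [Fintype V] [DecidableEq V] (G : SimpleGraph V)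
    (hfc : IsFactorCritical G)
    (k : ℕ) (P : Fin (k + 1) → List V) (hdec : IsOddEarDecomp G k P)
    (a b : V) (hab : G.Adj a b) (hodd : IsOddEdge k P a b)
    (j : Fin (k + 1)) (hj : s(a, b) ∈ listEdges (P j)) (hnontriv : 3 ≤ (P j).length)
    (v : V) (hv : earOf k P v < earOf k P a) :
    ∃ M : G.Subgraph, M.IsMatching ∧ M.verts = ({v} : Set V)ᶜ ∧ s(a, b) ∈ M.edgeSet := by
  have hmem : ∀ x, ∃ hi : earOf k P x < k + 1, x ∈ P ⟨earOf k P x, hi⟩ := by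
    intro x
    obtain ⟨i, hi⟩ := hdec.1.verts_cover x
    exact Nat.sInf_mem (s := {i : ℕ | ∃ hi : i < k + 1, x ∈ P ⟨i, hi⟩}) ⟨i.1, i.2, hi⟩
  have hnot : ∀ x, x ∉ WW k P (earOf k P x) := by
    rintro x ⟨i, hi, hx⟩
    exact Nat.notMem_of_lt_sInf hi ⟨i.2, hx⟩
  obtain ⟨hba, hodd⟩ := hodd
  obtain ⟨hi, p, q, hp, hq, ho1, ho2⟩ := hodd (by omega)
  have ha := hnot a
  have hb := hnot b
  rw [← hba] at hb
  have hvW : v ∈ WW k P (earOf k P a) := by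
    obtain ⟨h1, h2⟩ := hmem v
    exact ⟨⟨_, h1⟩, hv, h2⟩
  have hpos : earOf k P a ≠ 0 := by omega
  generalize earOf k P a = i at *
  -- the edge as a pair of consecutive positions
  obtain ⟨t, ht, hte⟩ : ∃ t, ∃ h : t + 1 < (P j).length, s((P j)[t], (P j)[t + 1]) = s(a, b) := by
    simp only [listEdges, List.mem_map] at hj
    obtain ⟨⟨x, y⟩, hxy, he⟩ := hj
    obtain ⟨t, h1, h2⟩ := List.mem_iff_getElem.1 hxy
    rw [List.getElem_zip, List.getElem_tail] at h2
    simp only [List.length_zip, List.length_tail] at h1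
    refine ⟨t, by omega, ?_⟩
    rw [← he, ← h2]
  have hpa : a ∈ P ⟨i, hi⟩ := hp ▸ List.get_mem _ _
  have hpb : b ∈ P ⟨i, hi⟩ := hq ▸ List.get_mem _ _
  obtain ⟨f, m, hE, hlen, hf, hWW⟩ := ear_to_fun hdec j _ rfl
  have haj : a ∈ P j ∧ b ∈ P j := by
    rw [Sym2.eq_iff] at hte
    rcases hte with ⟨h1, h2⟩ | ⟨h1, h2⟩ <;> rw [← h1, ← h2] <;> simp
  have hij : i ≤ j.1 := by
    by_contra h
    exact ha ⟨j, by omega, haj.1⟩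
  rw [if_neg (by omega)] at hE hWW
  rw [hf, hf] at hte
  have hji : j.1 = i := by
    by_contra h
    have haW : a ∈ WW k P j.1 := ⟨⟨i, hi⟩, by simp; omega, hpa⟩
    have hbW : b ∈ WW k P j.1 := ⟨⟨i, hi⟩, by simp; omega, hpb⟩
    have hft : f t ∈ WW k P j.1 ∧ f (t + 1) ∈ WW k P j.1 := by
      rw [Sym2.eq_iff] at hte
      rcases hte with ⟨h1, h2⟩ | ⟨h1, h2⟩ <;> rw [h1, h2] <;> simp [haW, hbW]
    rcases Nat.eq_zero_or_pos t with rfl | h0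
    · exact hE.new 1 (by omega) (by omega) hft.2
    · exact hE.new t (by omega) (by omega) hft.1
  subst hji
  have hnt : f t ∉ WW k P j.1 ∧ f (t + 1) ∉ WW k P j.1 := by
    rw [Sym2.eq_iff] at hte
    rcases hte with ⟨h1, h2⟩ | ⟨h1, h2⟩ <;> rw [h1, h2] <;> simp [ha, hb]
  have hposn : ∀ s, s ≤ m → f s ∉ WW k P j.1 → 1 ≤ s ∧ s < m := by
    intro s hs h
    constructor
    · by_contra h1
      obtain rfl : s = 0 := by omega
      exact h hE.first
    · by_contra h1
      obtain rfl : s = m := by omega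
      exact h hE.last
  have ht1 := hposn t (by omega) hnt.1
  have ht2 := hposn (t + 1) (by omega) hnt.2
  have hp' : f p.1 = a := by rw [← hf p.1 p.2]; exact hp
  have hq' : f q.1 = b := by rw [← hf q.1 q.2]; exact hq
  have hpl : p.1 < (P j).length := p.2
  have hql : q.1 < (P j).length := q.2
  have hp1 := hposn p.1 (by omega) (by rw [hp']; exact ha)
  have hq1 := hposn q.1 (by omega) (by rw [hq']; exact hb)
  have htodd : Odd t := by
    rw [Sym2.eq_iff] at hte
    rcases hte with ⟨h1, h2⟩ | ⟨h1, h2⟩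
    · have e1 : p.1 = t := hE.inj hp1 ht1 (hp'.trans h1.symm)
      have e2 : q.1 = t + 1 := hE.inj hq1 ht2 (hq'.trans h2.symm)
      rcases ho1 with ⟨_, h⟩ | ⟨h, _⟩
      · rwa [e1] at h
      · omega
    · have e1 : p.1 = t + 1 := hE.inj hp1 ht2 (hp'.trans h2.symm)
      have e2 : q.1 = t := hE.inj hq1 ht1 (hq'.trans h1.symm)
      rcases ho2 with ⟨_, h⟩ | ⟨h, _⟩
      · rwa [e2] at h
      · omega
  -- matching of the interior of the ear
  have hinter : PME G s(a, b) (f '' Set.Ico 1 m) := by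
    have m1 := PM.seg' f 1 t (by omega) (by
      obtain ⟨c, hc⟩ := htodd; exact ⟨c, by omega⟩)
      (hE.inj.mono (Set.Ico_subset_Ico_right (by omega))) (fun s _ h2 => hE.adj s (by omega))
    have m2 := PM.seg' f (t + 2) m (by omega) (by
      obtain ⟨c, hc⟩ := htodd; obtain ⟨d, hd⟩ := hE.hm; exact ⟨d - c - 1, by omega⟩)
      (hE.inj.mono (Set.Ico_subset_Ico_left (by omega))) (fun s _ h2 => hE.adj s (by omega))
    have m0 := PME.pair (hE.adj t (by omega))
    rw [hte, ← Set.image_pair] at m0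
    have m3 := (m0.union m1 (by
      refine injOn_disj hE.inj ?_ ?_ ?_
      · intro x; simp only [Set.mem_Ico, Set.mem_insert_iff, Set.mem_singleton_iff]; omega
      · intro x; simp only [Set.mem_Ico]; omega
      · rw [Set.disjoint_left]
        intro x; simp only [Set.mem_Ico, Set.mem_insert_iff, Set.mem_singleton_iff]; omega))
    rw [← Set.image_union] at m3
    have m4 := m3.union m2 (by
      refine injOn_disj hE.inj ?_ ?_ ?_
      · intro x
        simp only [Set.mem_union, Set.mem_Ico, Set.mem_insert_iff, Set.mem_singleton_iff]; omega
      · intro x; simp only [Set.mem_Ico]; omega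
      · rw [Set.disjoint_left]
        intro x
        simp only [Set.mem_union, Set.mem_Ico, Set.mem_insert_iff, Set.mem_singleton_iff]; omega)
    rw [← Set.image_union] at m4
    convert m4 using 2
    ext x
    simp only [Set.mem_union, Set.mem_Ico, Set.mem_insert_iff, Set.mem_singleton_iff]; omega
  -- all later stages
  have hall : ∀ n, j.1 ≤ n → n < k + 1 → PME G s(a, b) (WW k P (n + 1) \ {v}) := by
    intro n hn
    induction n, hn using Nat.le_induction with
    | base =>
      intro _
      have h0 : PM G (WW k P j.1 \ {v}) := by
        obtain ⟨n, hn⟩ := Nat.exists_eq_succ_of_ne_zero hpos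
        rw [hn] at hvW ⊢
        exact WW_fc hdec n (by omega) v hvW
      have := hinter.union h0 (hE.disj Set.sdiff_subset).symm
      rw [hWW, Set.union_sdiff_distrib,
        Set.sdiff_singleton_eq_self (Set.disjoint_left.1 (hE.disj subset_rfl) hvW), Set.union_comm]
      exact this
    | succ n hn ih =>
      intro hn'
      obtain ⟨g, l, hE', -, -, h2⟩ := ear_to_fun hdec ⟨n + 1, hn'⟩ _ rfl
      simp only [Nat.add_eq_zero_iff, one_ne_zero, and_false, if_false] at hE' h2
      have hvn : v ∈ WW k P (n + 1) := by
        obtain ⟨j', h1, h2⟩ := hvW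
        exact ⟨j', by omega, h2⟩
      have := (ih (by omega)).union hE'.internal (hE'.disj Set.sdiff_subset)
      rw [h2, Set.union_sdiff_distrib,
        Set.sdiff_singleton_eq_self (Set.disjoint_left.1 (hE'.disj subset_rfl) hvn)]
      exact this
  have hfin := hall k (by omega) (by omega)
  have huniv : WW k P (k + 1) = Set.univ := by
    ext x
    obtain ⟨i, hi⟩ := hdec.1.verts_cover x
    simp only [Set.mem_univ, iff_true]
    exact ⟨i, i.2, hi⟩
  rw [huniv, ← Set.compl_eq_univ_diff] at hfin
  exact hfin
end

section
/- Let G be a graph given with an odd ear-decomposition P_0 + P_1 + ... + P_k that has the minimum number of trivial ears among all odd ear-decompositions of G (equivalently, the maximum number of nontrivial ears). Then this ear-decomposition is maximal, i.e., for every odd edge e = ab with i := ear(a) = ear(b), the edge e belongs to the ear P_i. -/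
variable {V : Type*}

/-- The number of trivial ears (ears consisting of a single edge)
of an ear-decomposition. -/
def trivialCount (k : ℕ) (P : Fin (k + 1) → List V) : ℕ :=
  (Finset.univ.filter fun i : Fin (k + 1) => (P i).length = 2).card


theorem ed_cons (x y : V) (l : List V) :
    listEdges (x :: y :: l) = s(x, y) :: listEdges (y :: l) := by
  simp [listEdges]

theorem ed_one (x : V) : listEdges [x] = [] := by simp [listEdges]

theorem ed_append (l : List V) (x : V) (m : List V) :
    listEdges (l ++ x :: m) = listEdges (l ++ [x]) ++ listEdges (x :: m) := by
  induction l with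
  | nil => simp [ed_one]
  | cons y l ih =>
    cases l with
    | nil => simp [ed_cons, ed_one]
    | cons z l => simpa [ed_cons] using ih

theorem ed_append' (x : V) (l : List V) (y : V) (m : List V) :
    listEdges (x :: (l ++ y :: m)) = listEdges (x :: (l ++ [y])) ++ listEdges (y :: m) :=
  ed_append (x :: l) y m

theorem ed_mem {a b : V} {l : List V} (h : s(a, b) ∈ listEdges l) :
    ∃ X Z, l = X ++ a :: b :: Z ∨ l = X ++ b :: a :: Z := by
  induction l with
  | nil => simp [listEdges] at h
  | cons x l ih =>
    cases l with
    | nil => simp [ed_one] at h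
    | cons y l =>
      rw [ed_cons, List.mem_cons] at h
      rcases h with h | h
      · rw [Sym2.eq_iff] at h
        rcases h with ⟨rfl, rfl⟩ | ⟨rfl, rfl⟩
        · exact ⟨[], l, Or.inl rfl⟩
        · exact ⟨[], l, Or.inr rfl⟩
      · obtain ⟨X, Z, h | h⟩ := ih h
        · exact ⟨x :: X, Z, Or.inl (by rw [h]; rfl)⟩
        · exact ⟨x :: X, Z, Or.inr (by rw [h]; rfl)⟩

theorem pair_of_not_internal {a b : V} {X Z : List V}
    (ha : a ∉ listInternal (X ++ a :: b :: Z)) (hb : b ∉ listInternal (X ++ a :: b :: Z)) :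
    X = [] ∧ Z = [] := by
  constructor
  · cases X with
    | nil => rfl
    | cons x X =>
      exfalso; apply ha
      simp [listInternal, List.dropLast_append_of_ne_nil]
  · rcases List.eq_nil_or_concat Z with h | ⟨Z', z, rfl⟩
    · exact h
    · exfalso; apply hb
      have : X ++ a :: b :: (Z' ++ [z]) = (X ++ a :: b :: Z') ++ [z] := by simp
      cases X <;> simp [listInternal, this, List.dropLast_append_of_ne_nil, List.dropLast_cons_of_ne_nil]

theorem key_sort {k : ℕ} (key : Fin (k + 1) → ℕ) (hk : Function.Injective key)
    (h0 : ∀ x, key 0 ≤ key x) :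
    ∃ σ : Equiv.Perm (Fin (k + 1)), σ 0 = 0 ∧ ∀ x y, x < y ↔ key (σ x) < key (σ y) := by
  have hm : Monotone (key ∘ Tuple.sort key) := Tuple.monotone_sort key
  have hs : StrictMono (key ∘ Tuple.sort key) :=
    hm.strictMono_of_injective (hk.comp (Tuple.sort key).injective)
  refine ⟨Tuple.sort key, ?_, fun x y => (hs.lt_iff_lt).symm⟩
  apply hk
  apply le_antisymm _ (h0 _)
  have := hm (Fin.zero_le ((Tuple.sort key).symm 0))
  simpa using this

theorem core {V : Type*} (G : SimpleGraph V)
    (k : ℕ) (P : Fin (k + 1) → List V) (hdec : IsOddEarDecomp G k P)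
    (hmin : ∀ (k' : ℕ) (P' : Fin (k' + 1) → List V), IsOddEarDecomp G k' P' →
      trivialCount k P ≤ trivialCount k' P')
    (i j : Fin (k + 1)) (hij : i < j) (hj : (P j).length = 2) (e : Sym2 V)
    (hje : listEdges (P j) = [e]) (hjm : ∀ v ∈ P j, v ∈ P i) (N1 N2 : List V)
    (c1 : N1.Chain' G.Adj) (c2 : N2.Chain' G.Adj) (hv : ∀ v, v ∈ P i ↔ v ∈ N1 ∨ v ∈ N2)
    (l1 : 4 ≤ N1.length) (l2 : 4 ≤ N2.length)
    (o1 : Odd (N1.length - 1)) (o2 : Odd (N2.length - 1))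
    (hh : ∃ u, N2.head? = some u ∧ u ∈ N1) (hl : ∃ u, N2.getLast? = some u ∧ u ∈ N1)
    (n2 : (listInternal N2).Nodup) (n21 : ∀ v ∈ listInternal N2, v ∉ N1)
    (n2i : ∀ v ∈ listInternal N2, ∀ m < i, v ∉ P m)
    (he : (listEdges N1 ++ listEdges N2).Perm (e :: listEdges (P i)))
    (h0 : i = 0 → N1.head? = N1.getLast? ∧ N1.dropLast.Nodup)
    (h1 : 1 ≤ i.1 → N1.head? = (P i).head? ∧ N1.getLast? = (P i).getLast? ∧
      (listInternal N1).Sublist (listInternal (P i))) : False := by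
  classical
  obtain ⟨D, hodd⟩ := hdec
  have hne : j ≠ i := hij.ne'
  obtain ⟨R, hR⟩ : ∃ R : Fin (k + 1) → List V,
      R = fun x => if x = i then N1 else if x = j then N2 else P x := ⟨_, rfl⟩
  have Ri : R i = N1 := by simp [hR]
  have Rj : R j = N2 := by simp [hR, hne]
  have Rx : ∀ x, x ≠ i → x ≠ j → R x = P x := by intro x h h'; simp [hR, h, h']
  obtain ⟨key, hkey⟩ : ∃ key : Fin (k + 1) → ℕ,
      key = fun x => if x = j then 2 * i.1 + 1 else 2 * x.1 := ⟨_, rfl⟩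
  have kj : key j = 2 * i.1 + 1 := by simp [hkey]
  have kx : ∀ x, x ≠ j → key x = 2 * x.1 := by intro x h; simp [hkey, h]
  have ki := kx i hne.symm
  have hj0 : (0 : Fin (k + 1)) ≠ j := by
    intro h; rw [← h] at hij; exact absurd hij (Fin.not_lt_zero i)
  have hinj : Function.Injective key := by
    intro x y h
    by_cases hx : x = j <;> by_cases hy : y = j
    · rw [hx, hy]
    · rw [hx, kj, kx y hy] at h; omega
    · rw [hy, kj, kx x hx] at h; omega
    · rw [kx x hx, kx y hy] at h; ext; omega
  obtain ⟨σ, σ0, hσ⟩ := key_sort key hinj (by intro x; rw [kx 0 hj0]; simp)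
  -- comparisons
  have lt_of : ∀ x y, x ≠ i → x ≠ j → y < x → y ≠ j → key y < key x := by
    intro x y h1 h2 h3 h4
    rw [kx x h2, kx y h4]; have := Fin.lt_def.1 h3; omega
  have mem_old : ∀ x, x ≠ i → x ≠ j → ∀ u y, y < x → u ∈ P y →
      ∃ z, key z < key x ∧ u ∈ R z := by
    intro x hxi hxj u y hyx hu
    have key' : ∀ y, y < x → u ∈ P y → y ≠ j → ∃ z, key z < key x ∧ u ∈ R z := by
      intro y hyx hu hyj
      by_cases hyi : y = i
      · subst hyi
        rcases (hv u).1 hu with h | h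
        · exact ⟨y, lt_of x y hxi hxj hyx hyj, by rwa [Ri]⟩
        · refine ⟨j, ?_, by rwa [Rj]⟩
          rw [kj, kx x hxj]; have := Fin.lt_def.1 hyx; omega
      · exact ⟨y, lt_of x y hxi hxj hyx hyj, by rwa [Rx y hyi hyj]⟩
    by_cases hyj : y = j
    · subst hyj
      exact key' i (hij.trans hyx) (hjm u hu) hne.symm
    · exact key' y hyx hu hyj
  have mem_old_i : ∀ u y, y < i → u ∈ P y → ∃ z, key z < key i ∧ u ∈ R z := by
    intro u y hy hu
    refine ⟨y, ?_, ?_⟩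
    · rw [ki, kx y (hy.trans hij).ne]; have := Fin.lt_def.1 hy; omega
    · rwa [Rx y hy.ne (hy.trans hij).ne]
  have pos : ∀ x : Fin (k + 1), x ≠ 0 → 1 ≤ x.1 := by
    intro x hx
    rcases Nat.eq_zero_or_pos x.1 with h | h
    · exact absurd (Fin.ext h) hx
    · exact h
  have edn : (listEdges N1 ++ listEdges N2).Nodup := by
    rw [he.nodup_iff, List.nodup_cons]
    refine ⟨?_, D.edges_nodup i⟩
    exact D.edges_disjoint j i hne e (by simp [hje])
  have edmem : ∀ f, f ∈ listEdges N1 ∨ f ∈ listEdges N2 ↔ f ∈ listEdges (P j) ∨ f ∈ listEdges (P i) := by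
    intro f
    rw [← List.mem_append, he.mem_iff, hje]; simp
  have toQ : ∀ x u, (∃ z, key z < key (σ x) ∧ u ∈ R z) → ∃ y, y < x ∧ u ∈ R (σ y) := by
    rintro x u ⟨z, hz, hu⟩
    refine ⟨σ.symm z, ?_, by simpa using hu⟩
    rw [hσ]; simpa using hz
  have σne : ∀ x : Fin (k + 1), 1 ≤ x.1 → σ x ≠ 0 := by
    intro x hx h
    rw [← σ0] at h
    have := σ.injective h
    subst this; simp at hx
  have R0 : (i = 0 ∧ R 0 = N1) ∨ (i ≠ 0 ∧ R 0 = P 0) := by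
    by_cases h : i = 0
    · left; subst h; exact ⟨rfl, Ri⟩
    · right; exact ⟨h, Rx 0 (Ne.symm h) hj0⟩
  have first : ∀ x, x ≠ 0 → ∃ u, (R x).head? = some u ∧ ∃ z, key z < key x ∧ u ∈ R z := by
    intro x hx
    by_cases hxi : x = i
    · subst hxi
      obtain ⟨u, hu, m, hm, hum⟩ := D.ear_first x (pos x hx)
      exact ⟨u, by rw [Ri, (h1 (pos x hx)).1, hu], mem_old_i u m hm hum⟩
    by_cases hxj : x = j
    · subst hxj
      obtain ⟨u, hu, hu1⟩ := hh
      exact ⟨u, by rw [Rj, hu], i, by rw [ki, kj]; omega, by rwa [Ri]⟩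
    · obtain ⟨u, hu, m, hm, hum⟩ := D.ear_first x (pos x hx)
      exact ⟨u, by rw [Rx x hxi hxj, hu], mem_old x hxi hxj u m hm hum⟩
  have last : ∀ x, x ≠ 0 → ∃ u, (R x).getLast? = some u ∧ ∃ z, key z < key x ∧ u ∈ R z := by
    intro x hx
    by_cases hxi : x = i
    · subst hxi
      obtain ⟨u, hu, m, hm, hum⟩ := D.ear_last x (pos x hx)
      exact ⟨u, by rw [Ri, (h1 (pos x hx)).2.1, hu], mem_old_i u m hm hum⟩
    by_cases hxj : x = j
    · subst hxj
      obtain ⟨u, hu, hu1⟩ := hl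
      exact ⟨u, by rw [Rj, hu], i, by rw [ki, kj]; omega, by rwa [Ri]⟩
    · obtain ⟨u, hu, m, hm, hum⟩ := D.ear_last x (pos x hx)
      exact ⟨u, by rw [Rx x hxi hxj, hu], mem_old x hxi hxj u m hm hum⟩
  have inew : ∀ x, x ≠ 0 → ∀ v ∈ listInternal (R x), ∀ z, key z < key x → v ∉ R z := by
    intro x hx v hvx z hz
    by_cases hxi : x = i
    · subst hxi
      rw [Ri] at hvx
      have hzj : z ≠ j := by rintro rfl; rw [kj, ki] at hz; omega
      have hzx : z < x := by rw [kx z hzj, ki] at hz; rw [Fin.lt_def]; omega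
      rw [Rx z hzx.ne hzj]
      exact D.ear_internal_new x (pos x hx) v ((h1 (pos x hx)).2.2.subset hvx) z hzx
    by_cases hxj : x = j
    · subst hxj
      rw [Rj] at hvx
      have hzj : z ≠ x := by rintro rfl; omega
      by_cases hzi : z = i
      · subst hzi; rw [Ri]; exact n21 v hvx
      · rw [Rx z hzi hzj]
        apply n2i v hvx z
        rw [kj, kx z hzj] at hz
        have : z.1 ≠ i.1 := fun h => hzi (Fin.ext h)
        rw [Fin.lt_def]; omega
    · rw [Rx x hxi hxj] at hvx
      have new := D.ear_internal_new x (pos x hx) v hvx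
      have hxi' : x.1 ≠ i.1 := fun h => hxi (Fin.ext h)
      by_cases hzj : z = j
      · subst hzj
        rw [Rj]
        rw [kj, kx x hxj] at hz
        exact fun h => new i (by rw [Fin.lt_def]; omega) ((hv v).2 (Or.inr h))
      · have hzx : z < x := by rw [kx z hzj, kx x hxj] at hz; rw [Fin.lt_def]; omega
        by_cases hzi : z = i
        · subst hzi; rw [Ri]
          exact fun h => new z hzx ((hv v).2 (Or.inl h))
        · rw [Rx z hzi hzj]; exact new z hzx
  have ind : ∀ x, x ≠ 0 → (listInternal (R x)).Nodup := by
    intro x hx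
    by_cases hxi : x = i
    · subst hxi; rw [Ri]
      exact (h1 (pos x hx)).2.2.nodup (D.ear_internal_nodup x (pos x hx))
    by_cases hxj : x = j
    · subst hxj; rwa [Rj]
    · rw [Rx x hxi hxj]; exact D.ear_internal_nodup x (pos x hx)
  have ednR : ∀ x, (listEdges (R x)).Nodup := by
    intro x
    rw [List.nodup_append] at edn
    by_cases hxi : x = i
    · subst hxi; rw [Ri]; exact edn.1
    by_cases hxj : x = j
    · subst hxj; rw [Rj]; exact edn.2.1
    · rw [Rx x hxi hxj]; exact D.edges_nodup x
  have eddis : ∀ x y, x ≠ y → ∀ f ∈ listEdges (R x), f ∉ listEdges (R y) := by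
    have dN : ∀ f, f ∈ listEdges N1 → f ∈ listEdges N2 → False := by
      intro f hf1 hf2
      rw [List.nodup_append] at edn
      exact edn.2.2 f hf1 f hf2 rfl
    have dP : ∀ x, x ≠ i → x ≠ j → ∀ f ∈ listEdges (P x),
        ¬ (f ∈ listEdges N1 ∨ f ∈ listEdges N2) := by
      intro x hxi hxj f hf h
      rcases (edmem f).1 h with h | h
      · exact D.edges_disjoint x j hxj f hf h
      · exact D.edges_disjoint x i hxi f hf h
    intro x y hxy f hf hf'
    by_cases hxi : x = i
    · rw [hxi, Ri] at hf
      have hyi : y ≠ i := by rw [← hxi]; exact hxy.symm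
      by_cases hyj : y = j
      · rw [hyj, Rj] at hf'; exact dN f hf hf'
      · rw [Rx y hyi hyj] at hf'; exact dP y hyi hyj f hf' (Or.inl hf)
    by_cases hxj : x = j
    · rw [hxj, Rj] at hf
      have hyj : y ≠ j := by rw [← hxj]; exact hxy.symm
      by_cases hyi : y = i
      · rw [hyi, Ri] at hf'; exact dN f hf' hf
      · rw [Rx y hyi hyj] at hf'; exact dP y hyi hyj f hf' (Or.inr hf)
    · rw [Rx x hxi hxj] at hf
      by_cases hyi : y = i
      · rw [hyi, Ri] at hf'; exact dP x hxi hxj f hf (Or.inl hf')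
      by_cases hyj : y = j
      · rw [hyj, Rj] at hf'; exact dP x hxi hxj f hf (Or.inr hf')
      · rw [Rx y hyi hyj] at hf'; exact D.edges_disjoint x y hxy f hf hf'
  have Rall : ∀ (p : List V → Prop), p N1 → p N2 → (∀ x, p (P x)) → ∀ x, p (R x) := by
    intro p p1 p2 p3 x
    by_cases hxi : x = i
    · rw [hxi, Ri]; exact p1
    by_cases hxj : x = j
    · rw [hxj, Rj]; exact p2
    · rw [Rx x hxi hxj]; exact p3 x
  have ed : IsOddEarDecomp G k (R ∘ σ) := by
    refine ⟨⟨?_, ?_, ?_, ?_, ?_, ?_, ?_, ?_, ?_, ?_, ?_, ?_, ?_⟩, ?_⟩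
    · intro x; exact Rall _ c1 c2 D.chain (σ x)
    · simp only [Function.comp, σ0]
      rcases R0 with ⟨_, h⟩ | ⟨_, h⟩ <;> rw [h]
      · exact l1
      · exact D.circuit_len
    · simp only [Function.comp, σ0]
      rcases R0 with ⟨hi, h⟩ | ⟨_, h⟩ <;> rw [h]
      · exact (h0 hi).1
      · exact D.circuit_closed
    · simp only [Function.comp, σ0]
      rcases R0 with ⟨hi, h⟩ | ⟨_, h⟩ <;> rw [h]
      · exact (h0 hi).2
      · exact D.circuit_nodup
    · intro x _
      refine Rall (fun l => 2 ≤ l.length) (by omega) (by omega) ?_ (σ x)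
      intro y
      by_cases hy : y = 0
      · subst hy; have := D.circuit_len; omega
      · exact D.ear_len y (pos y hy)
    · intro x hx
      obtain ⟨u, hu, h⟩ := first (σ x) (σne x hx)
      exact ⟨u, hu, toQ x u h⟩
    · intro x hx
      obtain ⟨u, hu, h⟩ := last (σ x) (σne x hx)
      exact ⟨u, hu, toQ x u h⟩
    · intro x hx; exact ind _ (σne x hx)
    · intro x hx v hv y hy
      exact inew (σ x) (σne x hx) v hv (σ y) ((hσ y x).1 hy)
    · intro x; exact ednR _
    · intro x y hxy; exact eddis _ _ (fun h => hxy (σ.injective h))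
    · intro f hf
      suffices h : ∃ x, f ∈ listEdges (R x) by
        obtain ⟨x, hx⟩ := h
        exact ⟨σ.symm x, by simpa using hx⟩
      obtain ⟨x, hx⟩ := D.edges_cover f hf
      have key' : (f ∈ listEdges (P j) ∨ f ∈ listEdges (P i)) → ∃ x, f ∈ listEdges (R x) := by
        intro h
        rcases (edmem f).2 h with h | h
        · exact ⟨i, by rwa [Ri]⟩
        · exact ⟨j, by rwa [Rj]⟩
      by_cases hxi : x = i
      · subst hxi; exact key' (Or.inr hx)
      by_cases hxj : x = j
      · subst hxj; exact key' (Or.inl hx)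
      · exact ⟨x, by rwa [Rx x hxi hxj]⟩
    · intro v
      suffices h : ∃ x, v ∈ R x by
        obtain ⟨x, hx⟩ := h
        exact ⟨σ.symm x, by simpa using hx⟩
      obtain ⟨x, hx⟩ := D.verts_cover v
      have key' : v ∈ P i → ∃ x, v ∈ R x := by
        intro h
        rcases (hv v).1 h with h | h
        · exact ⟨i, by rwa [Ri]⟩
        · exact ⟨j, by rwa [Rj]⟩
      by_cases hxi : x = i
      · subst hxi; exact key' hx
      by_cases hxj : x = j
      · subst hxj; exact key' (hjm v hx)
      · exact ⟨x, by rwa [Rx x hxi hxj]⟩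
    · intro x; exact Rall (fun l => Odd (l.length - 1)) o1 o2 hodd (σ x)
  have hle := hmin k _ ed
  have hc : trivialCount k (R ∘ σ) = trivialCount k R := by
    unfold trivialCount
    exact Finset.card_equiv σ (by intro x; simp)
  have hlt : trivialCount k R < trivialCount k P := by
    unfold trivialCount
    apply Finset.card_lt_card
    rw [Finset.ssubset_iff_of_subset]
    · refine ⟨j, by simp [hj], ?_⟩
      simp only [Finset.mem_filter, Rj]; omega
    · intro x
      simp only [Finset.mem_filter, Finset.mem_univ, true_and]
      by_cases hxi : x = i
      · rw [hxi, Ri]; omega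
      by_cases hxj : x = j
      · rw [hxj, Rj]; omega
      · rw [Rx x hxi hxj]; exact id
  omega

theorem split_odd {V : Type*} (G : SimpleGraph V)
    (k : ℕ) (P : Fin (k + 1) → List V) (hdec : IsOddEarDecomp G k P)
    (hmin : ∀ (k' : ℕ) (P' : Fin (k' + 1) → List V), IsOddEarDecomp G k' P' →
      trivialCount k P ≤ trivialCount k' P')
    (i j : Fin (k + 1)) (hij : i < j) (hj : (P j).length = 2) (a b : V)
    (hje : listEdges (P j) = [s(a, b)]) (hjm : ∀ v ∈ P j, v ∈ P i) (hab : G.Adj a b)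
    (X Y Z : List V) (z : V) (hA : P i = X ++ a :: (Y ++ b :: (Z ++ [z])))
    (hY : Even Y.length) (hY0 : Y ≠ []) (hX : 1 ≤ i.1 → X ≠ []) : False := by
  have hE : Even (P i).length := by
    have h1 := hdec.2 i
    have h2 : 1 ≤ (P i).length := by rw [hA]; simp; omega
    obtain ⟨r, hr⟩ := h1
    exact ⟨r + 1, by omega⟩
  have hl : (P i).length = X.length + Y.length + Z.length + 3 := by
    rw [hA]; simp; omega
  have hYl : 2 ≤ Y.length := by
    obtain ⟨r, hr⟩ := hY
    have : Y.length ≠ 0 := by simpa using hY0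
    omega
  have hc : List.IsChain G.Adj (X ++ a :: (Y ++ b :: (Z ++ [z]))) := by
    rw [← hA]; exact hdec.1.chain i
  have hc1 := List.isChain_split.1 hc
  have hc2 : List.IsChain G.Adj ((a :: Y) ++ b :: (Z ++ [z])) := hc1.2
  have hc3 := List.isChain_split.1 hc2
  -- disjointness
  have dis : Y.Nodup ∧ (∀ v ∈ Y, v ∉ X ++ a :: b :: (Z ++ [z])) := by
    rcases Nat.eq_zero_or_pos i.1 with h | h
    · have h : i = 0 := Fin.ext h
      subst h
      have hn := hdec.1.circuit_nodup
      have hcl := hdec.1.circuit_closed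
      rw [hA] at hn hcl
      have e1 : X ++ a :: (Y ++ b :: (Z ++ [z])) = (X ++ a :: (Y ++ b :: Z)) ++ [z] := by simp
      rw [e1, List.dropLast_concat] at hn
      rw [e1, List.getLast?_concat] at hcl
      have hz : z ∈ X ++ [a] := by
        cases X with
        | nil => simp at hcl; simp [hcl]
        | cons x X => simp at hcl; simp [hcl]
      simp only [List.nodup_append, List.nodup_cons, List.mem_append, List.mem_cons] at hn
      simp only [List.mem_append, List.mem_cons, List.not_mem_nil, or_false] at hz ⊢
      refine ⟨by tauto, ?_⟩
      intro v hv
      grind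
    · have hn := hdec.1.ear_internal_nodup i h
      have hnew := hdec.1.ear_internal_new i h
      obtain ⟨u, hu, m, hm, hum⟩ := hdec.1.ear_first i h
      obtain ⟨w, hw, m', hm', hwm⟩ := hdec.1.ear_last i h
      cases X with
      | nil => exact absurd rfl (hX h)
      | cons x X =>
        have e1 : x :: X ++ a :: (Y ++ b :: (Z ++ [z])) = x :: (X ++ a :: (Y ++ b :: Z)) ++ [z] := by simp
        have e2 : listInternal (P i) = X ++ a :: (Y ++ b :: Z) := by
          rw [hA, e1, listInternal, List.cons_append, List.tail_cons, List.dropLast_concat]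
        rw [e2] at hn hnew
        rw [hA] at hu hw
        rw [e1, List.getLast?_concat] at hw
        simp at hu hw
        subst hu hw
        simp only [List.nodup_append, List.nodup_cons, List.mem_append, List.mem_cons] at hn
        refine ⟨by tauto, ?_⟩
        intro v hv
        have h1 : v ≠ x := by rintro rfl; exact hnew v (by simp [hv]) m hm hum
        have h2 : v ≠ z := by rintro rfl; exact hnew v (by simp [hv]) m' hm' hwm
        simp only [List.mem_append, List.mem_cons, List.not_mem_nil, or_false]
        grind
  have hin : listInternal (a :: (Y ++ [b])) = Y := by simp [listInternal]
  refine core G k P hdec hmin i j hij hj s(a, b) hje hjm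
    (X ++ a :: b :: (Z ++ [z])) (a :: (Y ++ [b])) ?_ ?_ ?_ ?_ ?_ ?_ ?_ ?_ ?_ ?_ ?_ ?_ ?_ ?_ ?_
  · refine List.isChain_split.2 ⟨hc1.1, ?_⟩
    rw [List.isChain_cons_cons]
    exact ⟨hab, hc3.2⟩
  · exact hc3.1
  · intro v; rw [hA]; simp; tauto
  · simp
    obtain ⟨r, hr⟩ := hE
    obtain ⟨s, hs⟩ := hY
    omega
  · simp; omega
  · obtain ⟨r, hr⟩ := hE
    obtain ⟨s, hs⟩ := hY
    refine ⟨r - s - 1, ?_⟩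
    simp; omega
  · obtain ⟨s, hs⟩ := hY
    refine ⟨s, ?_⟩
    simp; omega
  · exact ⟨a, by simp, by simp⟩
  · refine ⟨b, ?_, by simp⟩
    rw [← List.cons_append, List.getLast?_concat]
  · rw [hin]; exact dis.1
  · rw [hin]; exact dis.2
  · rw [hin]; intro v hv m hm
    rcases Nat.eq_zero_or_pos i.1 with h | h
    · rw [Fin.lt_def] at hm; omega
    · refine hdec.1.ear_internal_new i h v ?_ m hm
      rw [hA]
      cases X with
      | nil => exact absurd rfl (hX h)
      | cons x X =>
        simp [listInternal, List.dropLast_append_of_ne_nil, List.dropLast_cons_of_ne_nil, hv]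
  · rw [hA, ed_append X a (b :: _), ed_cons, ed_append X a (Y ++ _), ed_append' a Y b (Z ++ _)]
    rw [← Multiset.coe_eq_coe]
    simp only [← Multiset.coe_add, ← Multiset.cons_coe, ← Multiset.singleton_add]
    abel
  · intro h; subst h
    have hn := hdec.1.circuit_nodup
    have hcl := hdec.1.circuit_closed
    rw [hA] at hn hcl
    have e1 : X ++ a :: (Y ++ b :: (Z ++ [z])) = (X ++ a :: (Y ++ b :: Z)) ++ [z] := by simp
    have e2 : X ++ a :: b :: (Z ++ [z]) = (X ++ a :: b :: Z) ++ [z] := by simp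
    rw [e1, List.dropLast_concat] at hn
    rw [e1, List.getLast?_concat] at hcl
    rw [e2, List.dropLast_concat, List.getLast?_concat]
    constructor
    · rw [← hcl]; cases X <;> simp
    · refine List.Sublist.nodup ?_ hn
      refine (List.Sublist.refl X).append ?_
      exact (List.sublist_append_right Y (b :: Z)).cons_cons a
  · intro h
    rw [hA]
    cases X with
    | nil => exact absurd rfl (hX h)
    | cons x X =>
      have e1 : x :: X ++ a :: (Y ++ b :: (Z ++ [z])) = x :: (X ++ a :: (Y ++ b :: Z)) ++ [z] := by simp
      have e2 : x :: X ++ a :: b :: (Z ++ [z]) = x :: (X ++ a :: b :: Z) ++ [z] := by simp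
      rw [e1, e2, listInternal, listInternal, List.getLast?_concat, List.getLast?_concat]
      simp only [List.cons_append, List.tail_cons, List.dropLast_concat, List.head?_cons, true_and]
      refine (List.Sublist.refl X).append ?_
      exact (List.sublist_append_right Y (b :: Z)).cons_cons a

set_option maxHeartbeats 2000000 in
theorem split_even {V : Type*} (G : SimpleGraph V)
    (k : ℕ) (P : Fin (k + 1) → List V) (hdec : IsOddEarDecomp G k P)
    (hmin : ∀ (k' : ℕ) (P' : Fin (k' + 1) → List V), IsOddEarDecomp G k' P' →
      trivialCount k P ≤ trivialCount k' P')
    (j : Fin (k + 1)) (hij : 0 < j) (hj : (P j).length = 2) (a b : V)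
    (hje : listEdges (P j) = [s(a, b)]) (hjm : ∀ v ∈ P j, v ∈ P 0) (hab : G.Adj a b)
    (X Y Z : List V) (z : V) (hA : P 0 = X ++ a :: (Y ++ b :: (Z ++ [z])))
    (hY : Odd Y.length) (hX : Z ++ X ≠ []) : False := by
  have hE : Even (P 0).length := by
    have h1 := hdec.2 0
    have h2 : 1 ≤ (P 0).length := by rw [hA]; simp; omega
    obtain ⟨r, hr⟩ := h1
    exact ⟨r + 1, by omega⟩
  have hl : (P 0).length = X.length + Y.length + Z.length + 3 := by
    rw [hA]; simp; omega
  have hYl : 1 ≤ Y.length := hY.pos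
  have hXl : 1 ≤ X.length + Z.length := by
    have := List.length_pos_iff.2 hX
    simp at this; omega
  have hc : List.IsChain G.Adj (X ++ a :: (Y ++ b :: (Z ++ [z]))) := by
    rw [← hA]; exact hdec.1.chain 0
  have hc1 := List.isChain_split.1 hc
  have hc2 : List.IsChain G.Adj ((a :: Y) ++ b :: (Z ++ [z])) := hc1.2
  have hc3 := List.isChain_split.1 hc2
  have hn := hdec.1.circuit_nodup
  have hcl := hdec.1.circuit_closed
  rw [hA] at hn hcl
  have e1 : X ++ a :: (Y ++ b :: (Z ++ [z])) = (X ++ a :: (Y ++ b :: Z)) ++ [z] := by simp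
  rw [e1, List.dropLast_concat] at hn
  rw [e1, List.getLast?_concat] at hcl
  obtain ⟨W, hW⟩ : ∃ W, X ++ [a] = z :: W := by
    cases X with
    | nil => simp at hcl; exact ⟨[], by simp [hcl]⟩
    | cons x X => simp at hcl; exact ⟨X ++ [a], by simp [hcl]⟩
  have hin : listInternal (b :: (Z ++ (X ++ [a]))) = Z ++ X := by
    rw [← List.append_assoc]; simp only [listInternal, List.tail_cons, List.dropLast_concat]
  have hz : z ∈ X ++ [a] := by rw [hW]; simp
  refine core G k P hdec hmin 0 j hij hj s(a, b) hje hjm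
    (a :: (Y ++ [b, a])) (b :: (Z ++ (X ++ [a]))) ?_ ?_ ?_ ?_ ?_ ?_ ?_ ?_ ?_ ?_ ?_ ?_ ?_ ?_ ?_
  · change List.IsChain G.Adj ((a :: Y) ++ b :: [a])
    rw [List.isChain_split]
    exact ⟨hc3.1, by simp [hab.symm]⟩
  · rw [hW]
    change List.IsChain G.Adj ((b :: Z) ++ z :: W)
    rw [List.isChain_split, ← hW]
    exact ⟨hc3.2, hc1.1⟩
  · intro v; rw [hA]
    simp only [List.mem_append, List.mem_cons, List.not_mem_nil, or_false] at hz ⊢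
    have : v = z → v ∈ X ∨ v = a := by rintro rfl; exact hz
    tauto
  · simp only [List.length_cons, List.length_append, List.length_nil]; omega
  · simp only [List.length_cons, List.length_append, List.length_nil]
    obtain ⟨r, hr⟩ := hE
    obtain ⟨s, hs⟩ := hY
    omega
  · obtain ⟨s, hs⟩ := hY
    refine ⟨s + 1, ?_⟩
    simp only [List.length_cons, List.length_append, List.length_nil]; omega
  · obtain ⟨r, hr⟩ := hE
    obtain ⟨s, hs⟩ := hY
    refine ⟨r - s - 2, ?_⟩
    simp only [List.length_cons, List.length_append, List.length_nil]; omega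
  · exact ⟨b, by simp, by simp⟩
  · refine ⟨a, ?_, by simp⟩
    rw [← List.append_assoc, ← List.cons_append, List.getLast?_concat]
  · rw [hin]
    simp only [List.nodup_append, List.nodup_cons, List.mem_append, List.mem_cons] at hn ⊢
    grind
  · rw [hin]
    simp only [List.nodup_append, List.nodup_cons, List.mem_append, List.mem_cons] at hn ⊢
    grind
  · intro v _ m hm
    exact absurd hm (Fin.not_lt_zero m)
  · rw [hA, ed_append X a (Y ++ _), ed_append' a Y b (Z ++ _), ed_append' a Y b [a], ed_cons b a,
      ed_one, hW, ed_append' b Z z W, Sym2.eq_swap]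
    rw [← Multiset.coe_eq_coe]
    simp only [← Multiset.coe_add, ← Multiset.cons_coe, ← Multiset.singleton_add, Multiset.coe_nil]
    abel
  · intro _
    have e2 : a :: (Y ++ [b, a]) = (a :: (Y ++ [b])) ++ [a] := by simp
    rw [e2, List.dropLast_concat, List.getLast?_concat]
    refine ⟨by simp, ?_⟩
    simp only [List.nodup_append, List.nodup_cons, List.mem_append, List.mem_cons] at hn ⊢
    grind
  · intro h; simp at h

theorem trivial_ear {V : Type*} (G : SimpleGraph V)
    (k : ℕ) (P : Fin (k + 1) → List V) (D : IsEarDecomp G k P) (a b : V) (hab : G.Adj a b)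
    (hab' : earOf k P a = earOf k P b) (i : Fin (k + 1)) (hi : i.1 = earOf k P a)
    (ha : a ∈ P i) (hb : b ∈ P i) (hne : s(a, b) ∉ listEdges (P i)) :
    ∃ j, i < j ∧ (P j).length = 2 ∧ listEdges (P j) = [s(a, b)] ∧ ∀ v ∈ P j, v ∈ P i := by
  obtain ⟨j, hj⟩ := D.edges_cover s(a, b) hab
  have hji : j ≠ i := by rintro rfl; exact hne hj
  have haj : a ∈ P j := by
    obtain ⟨X, Z, h | h⟩ := ed_mem hj <;> rw [h] <;> simp
  have hle : i ≤ j := by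
    rw [Fin.le_def, hi]
    exact Nat.sInf_le ⟨j.2, haj⟩
  have hlt : i < j := lt_of_le_of_ne hle hji.symm
  have hpos : 1 ≤ j.1 := by have := Fin.lt_def.1 hlt; omega
  have ha' : a ∉ listInternal (P j) := fun h => D.ear_internal_new j hpos a h i hlt ha
  have hb' : b ∉ listInternal (P j) := fun h => D.ear_internal_new j hpos b h i hlt hb
  refine ⟨j, hlt, ?_⟩
  obtain ⟨X, Z, h | h⟩ := ed_mem hj
  · rw [h] at ha' hb'
    obtain ⟨rfl, rfl⟩ := pair_of_not_internal ha' hb'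
    rw [h]
    refine ⟨rfl, by simp [ed_cons, ed_one], ?_⟩
    intro v hv; simp at hv
    rcases hv with rfl | rfl <;> assumption
  · rw [h] at ha' hb'
    obtain ⟨rfl, rfl⟩ := pair_of_not_internal hb' ha'
    rw [h]
    refine ⟨rfl, by simp [ed_cons, ed_one, Sym2.eq_swap], ?_⟩
    intro v hv; simp at hv
    rcases hv with rfl | rfl <;> assumption

theorem split_list {V : Type*} (l : List V) (p q : Fin l.length) (hpq : p.1 < q.1)
    (hq : q.1 + 1 < l.length) :
    ∃ X Y Z z, l = X ++ l.get p :: (Y ++ l.get q :: (Z ++ [z])) ∧ X.length = p.1 ∧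
      X.length + 1 + Y.length = q.1 := by
  have h1 : l = l.take q ++ l.get q :: l.drop (q + 1) := by simp
  have h2 : l.take q = (l.take q).take p ++ (l.take q)[p.1]'(by simp; omega) ::
      (l.take q).drop (p + 1) := by
    rw [← List.drop_eq_getElem_cons, List.take_append_drop]
  have h3 : l.drop (q + 1) ≠ [] := by simp; omega
  have h4 := List.dropLast_append_getLast h3
  refine ⟨(l.take q).take p, (l.take q).drop (p + 1), (l.drop (q + 1)).dropLast,
    (l.drop (q + 1)).getLast h3, ?_, ?_, ?_⟩
  · rw [h4]
    conv_lhs => rw [h1, h2]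
    simp
  · simp; omega
  · simp; omega

theorem main_ear {V : Type*} (G : SimpleGraph V)
    (k : ℕ) (P : Fin (k + 1) → List V) (hdec : IsOddEarDecomp G k P)
    (hmin : ∀ (k' : ℕ) (P' : Fin (k' + 1) → List V), IsOddEarDecomp G k' P' →
      trivialCount k P ≤ trivialCount k' P')
    (a b : V) (hab : G.Adj a b) (hab' : earOf k P a = earOf k P b)
    (i : Fin (k + 1)) (hi : i.1 = earOf k P a) (hne : s(a, b) ∉ listEdges (P i))
    (p q : Fin (P i).length) (hp : (P i).get p = a) (hq : (P i).get q = b) (hpq : p.1 < q.1)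
    (hql : q.1 + 1 < (P i).length)
    (h : (Odd p.1 ∧ Odd ((P i).length - 1 - q.1)) ∨ i = 0) : False := by
  obtain ⟨j, hij, hj, hje, hjm⟩ := trivial_ear G k P hdec.1 a b hab hab' i hi
    (by rw [← hp]; exact List.get_mem _ _) (by rw [← hq]; exact List.get_mem _ _) hne
  obtain ⟨X, Y, Z, z, hA, hX, hY⟩ := split_list (P i) p q hpq hql
  rw [hp, hq] at hA
  have hY0 : Y ≠ [] := by
    rintro rfl
    apply hne
    rw [hA, ed_append X a, List.nil_append, ed_cons]; simp
  rcases h with ⟨h1, h2⟩ | rfl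
  · refine split_odd G k P hdec hmin i j hij hj a b hje hjm hab X Y Z z hA ?_ hY0 ?_
    · obtain ⟨r, hr⟩ := h1
      obtain ⟨s, hs⟩ := h2
      obtain ⟨t, ht⟩ := hdec.2 i
      exact ⟨t - s - r - 1 , by omega⟩
    · rintro _ rfl
      rw [← hX] at h1; simp at h1
  · rcases Nat.even_or_odd Y.length with h | h
    · exact split_odd G k P hdec hmin 0 j hij hj a b hje hjm hab X Y Z z hA h hY0 (by simp)
    · refine split_even G k P hdec hmin j hij hj a b hje hjm hab X Y Z z hA h ?_
      intro h0
      obtain ⟨rfl, rfl⟩ := List.append_eq_nil_iff.1 h0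
      have hcl := hdec.1.circuit_closed
      apply hne
      rw [hA] at hcl ⊢
      have e1 : ([] : List V) ++ a :: (Y ++ b :: ([] ++ [z])) = a :: (Y ++ [b]) ++ [z] := by simp
      rw [e1, List.getLast?_concat] at hcl
      simp at hcl
      subst hcl
      have e2 : ([] : List V) ++ a :: (Y ++ b :: ([] ++ [a])) = (a :: Y) ++ b :: [a] := by simp
      rw [e2, ed_append, ed_cons, Sym2.eq_swap]; simp

theorem circuit_pos {V : Type*} {l : List V} (h4 : 4 ≤ l.length) (hc : l.head? = l.getLast?)
    {a : V} (ha : a ∈ l) : ∃ p : Fin l.length, l.get p = a ∧ p.1 + 1 < l.length := by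
  obtain ⟨p, hp⟩ := List.get_of_mem ha
  by_cases h : p.1 + 1 < l.length
  · exact ⟨p, hp, h⟩
  · refine ⟨⟨0, by omega⟩, ?_, by simp; omega⟩
    rw [List.head?_eq_getElem?, List.getLast?_eq_getElem?] at hc
    have hpl : p.1 = l.length - 1 := by omega
    rw [← hpl, List.getElem?_eq_getElem p.2, List.getElem?_eq_getElem (by omega)] at hc
    simp at hc
    simpa [hc] using hp

/-- An odd ear-decomposition with the minimum number of trivial
ears among all odd ear-decompositions of `G` is maximal: every odd edge `ab`
with `i := ear a = ear b` belongs to the ear `P i`. -/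
theorem stmt_1 {V : Type*} [Fintype V] [DecidableEq V] (G : SimpleGraph V)
    (k : ℕ) (P : Fin (k + 1) → List V) (hdec : IsOddEarDecomp G k P)
    (hmin : ∀ (k' : ℕ) (P' : Fin (k' + 1) → List V), IsOddEarDecomp G k' P' →
      trivialCount k P ≤ trivialCount k' P') :
    ∀ a b : V, G.Adj a b → IsOddEdge k P a b →
      ∃ hi : earOf k P a < k + 1, s(a, b) ∈ listEdges (P ⟨earOf k P a, hi⟩) := by
  intro a b hab ⟨heq, hodd⟩
  have spec : ∀ v, ∃ hi : earOf k P v < k + 1, v ∈ P ⟨earOf k P v, hi⟩ := by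
    intro v
    have hne : {i : ℕ | ∃ hi : i < k + 1, v ∈ P ⟨i, hi⟩}.Nonempty := by
      obtain ⟨i, hi⟩ := hdec.1.verts_cover v
      exact ⟨i.1, i.2, hi⟩
    exact Nat.sInf_mem hne
  obtain ⟨hi, ha⟩ := spec a
  obtain ⟨hi', hb⟩ := spec b
  refine ⟨hi, ?_⟩
  by_contra hne
  have hne' : s(b, a) ∉ listEdges (P ⟨earOf k P a, hi⟩) := by rwa [Sym2.eq_swap]
  rcases Nat.eq_zero_or_pos (earOf k P a) with h0 | h1
  · have hi0 : (⟨earOf k P a, hi⟩ : Fin (k + 1)) = 0 := Fin.ext h0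
    have hi0' : (⟨earOf k P b, hi'⟩ : Fin (k + 1)) = 0 := Fin.ext (heq.symm.trans h0)
    rw [hi0] at ha hne hne'
    rw [hi0'] at hb
    obtain ⟨p, hp, hpl⟩ := circuit_pos hdec.1.circuit_len hdec.1.circuit_closed ha
    obtain ⟨q, hq, hql⟩ := circuit_pos hdec.1.circuit_len hdec.1.circuit_closed hb
    rcases lt_trichotomy p.1 q.1 with h | h | h
    · exact main_ear G k P hdec hmin a b hab heq 0 (by simp [h0]) hne p q hp hq h hql (Or.inr rfl)
    · have : p = q := Fin.ext h
      subst this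
      exact hab.ne (hp.symm.trans hq)
    · exact main_ear G k P hdec hmin b a hab.symm heq.symm 0 (by simp [← heq, h0]) hne' q p hq hp h
        hpl (Or.inr rfl)
  · obtain ⟨_, p, q, hp, hq, h⟩ := hodd h1
    rcases h with ⟨⟨hpq, h1⟩ | ⟨hpq, h1⟩, ⟨hpq', h2⟩ | ⟨hpq', h2⟩⟩
    · omega
    · exact main_ear G k P hdec hmin a b hab heq _ rfl hne p q hp hq hpq
        (by have := h2.pos; omega) (Or.inl ⟨h1, h2⟩)
    · exact main_ear G k P hdec hmin b a hab.symm heq.symm _ heq hne' q p hq hp hpq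
        (by have := h1.pos; omega) (Or.inl ⟨h2, h1⟩)
    · omega
end

section
/- Let G be a graph given with an odd ear-decomposition P_0 + P_1 + ... + P_k in which some odd edge e = ab with i := ear(a) = ear(b) does not belong to the ear P_i. Then e itself constitutes a trivial ear P_j for some j > i, and replacing the two ears P_i and P_j = {e} by two suitable odd ears yields an odd ear-decomposition of G with strictly fewer trivial ears. -/
variable {V : Type*}

section helpers

theorem listEdges_append {V : Type*} (A : List V) (c : V) (L : List V) :
    listEdges (A ++ c :: L) = listEdges (A ++ [c]) ++ listEdges (c :: L) := by
  induction A with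
  | nil => rfl
  | cons x A ih =>
    cases A with
    | nil => rfl
    | cons y A =>
      change s(x, y) :: listEdges (y :: A ++ c :: L) = s(x, y) :: listEdges (y :: A ++ [c]) ++ _
      rw [ih]; rfl

theorem listEdges_cons_cons {V : Type*} (x y : V) (L : List V) :
    listEdges (x :: y :: L) = s(x, y) :: listEdges (y :: L) := rfl

theorem listEdges_single {V : Type*} (x : V) : listEdges [x] = [] := rfl

theorem chain_iff_edges {V : Type*} (G : SimpleGraph V) (l : List V) :
    l.IsChain G.Adj ↔ ∀ e ∈ listEdges l, e ∈ G.edgeSet := by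
  induction l with
  | nil => simp [listEdges]
  | cons x l ih =>
    cases l with
    | nil => simp [listEdges]
    | cons y l =>
      rw [listEdges_cons_cons, List.isChain_cons_cons, ih]
      simp

theorem exists_split_of_mem_edges {V : Type*} (a b : V) (l : List V)
    (h : s(a, b) ∈ listEdges l) :
    ∃ A B, l = A ++ a :: b :: B ∨ l = A ++ b :: a :: B := by
  induction l with
  | nil => simp [listEdges] at h
  | cons x l ih =>
    cases l with
    | nil => simp [listEdges] at h
    | cons y l =>
      rw [listEdges_cons_cons, List.mem_cons] at h
      rcases h with h | h
      · rw [Sym2.eq_iff] at h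
        rcases h with ⟨rfl, rfl⟩ | ⟨rfl, rfl⟩
        · exact ⟨[], l, Or.inl rfl⟩
        · exact ⟨[], l, Or.inr rfl⟩
      · obtain ⟨A, B, h | h⟩ := ih h
        · exact ⟨x :: A, B, Or.inl (by rw [h]; rfl)⟩
        · exact ⟨x :: A, B, Or.inr (by rw [h]; rfl)⟩

theorem mem_of_mem_internal {V : Type*} {l : List V} {v : V} (h : v ∈ listInternal l) : v ∈ l :=
  List.mem_of_mem_tail (List.mem_of_mem_dropLast h)

theorem split_at_two {V : Type*} (l : List V) (p q : ℕ) (hpq : p < q) (hq : q < l.length) :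
    ∃ A M B, l = A ++ l[p] :: (M ++ l[q] :: B) ∧ A.length = p ∧ M.length = q - p - 1 ∧
      B.length = l.length - 1 - q := by
  refine ⟨l.take p, (l.drop (p+1)).take (q-p-1), l.drop (q+1), ?_, ?_, ?_, ?_⟩
  · have h1 : l = l.take p ++ l[p] :: l.drop (p+1) := by
      rw [← List.drop_eq_getElem_cons]; simp
    have h2 : l.drop (p+1) = (l.drop (p+1)).take (q-p-1) ++ l[q] :: l.drop (q+1) := by
      rw [← List.drop_eq_getElem_cons]
      have : l.drop q = (l.drop (p+1)).drop (q-p-1) := by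
        rw [List.drop_drop]; congr 1; omega
      rw [this, List.take_append_drop]
    rw [← h2]; exact h1
  · simp; omega
  · simp; omega
  · simp; omega

theorem exists_shift (k : ℕ) (i j : Fin (k+1)) (hij : i < j) :
    ∃ τ : Equiv.Perm (Fin (k+1)), τ i < τ j ∧ (∀ m, m ≠ j → (τ j < τ m ↔ i < m)) ∧
      (∀ l m, l ≠ j → m ≠ j → (τ l < τ m ↔ l < m)) ∧ τ 0 = 0 := by
  let f : Fin (k+1) → Fin (k+1) := fun n =>
    if n ≤ i then n else if h : n < j then ⟨n.1 + 1, by have := j.2; omega⟩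
    else if n = j then ⟨i.1 + 1, by have := j.2; omega⟩ else n
  have hf : ∀ n, (f n).1 = if n.1 ≤ i.1 then n.1 else if n.1 < j.1 then n.1 + 1
      else if n.1 = j.1 then i.1 + 1 else n.1 := by
    intro n
    simp only [f, Fin.le_def, Fin.lt_def, Fin.ext_iff]
    split_ifs <;> rfl
  have hij' : i.1 < j.1 := hij
  have inj : Function.Injective f := by
    intro x y h
    have h' := congrArg Fin.val h
    rw [hf, hf] at h'
    ext
    split_ifs at h' <;> omega
  refine ⟨Equiv.ofBijective f (Finite.injective_iff_bijective.1 inj), ?_, ?_, ?_, ?_⟩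
  · simp only [Equiv.ofBijective_apply, Fin.lt_def, hf]
    split_ifs <;> omega
  · intro m hm
    have hm' : m.1 ≠ j.1 := fun h => hm (Fin.ext h)
    simp only [Equiv.ofBijective_apply, Fin.lt_def, hf]
    split_ifs <;> omega
  · intro l m hl hm
    have hm' : m.1 ≠ j.1 := fun h => hm (Fin.ext h)
    have hl' : l.1 ≠ j.1 := fun h => hl (Fin.ext h)
    simp only [Equiv.ofBijective_apply, Fin.lt_def, hf]
    split_ifs <;> omega
  · ext
    simp only [Equiv.ofBijective_apply, hf]
    simp

/-- The data needed for a replacement of the ears `R = P i` and `E = P j` by `Q₁`, `Q₂`. -/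
structure Replacement {V : Type*} (first : Prop) (R E Q₁ Q₂ : List V) : Prop where
  circ : first → 4 ≤ Q₁.length ∧ Q₁.head? = Q₁.getLast? ∧ Q₁.dropLast.Nodup
  ear : ¬ first → Q₁.head? = R.head? ∧ Q₁.getLast? = R.getLast? ∧ (listInternal Q₁).Nodup ∧
    (∀ v ∈ listInternal Q₁, v ∈ listInternal R) ∧ (∀ v ∈ listInternal Q₂, v ∈ listInternal R)
  len1 : 3 ≤ Q₁.length
  len2 : 3 ≤ Q₂.length
  first2 : ∃ u, Q₂.head? = some u ∧ u ∈ Q₁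
  last2 : ∃ u, Q₂.getLast? = some u ∧ u ∈ Q₁
  nodup2 : (listInternal Q₂).Nodup
  new2 : ∀ v ∈ listInternal Q₂, v ∉ Q₁
  verts : ∀ v, v ∈ R ↔ v ∈ Q₁ ∨ v ∈ Q₂
  sub : ∀ v ∈ E, v ∈ Q₁
  edges : (listEdges Q₁ ++ listEdges Q₂).Perm (listEdges R ++ listEdges E)
  odd1 : Odd (Q₁.length - 1)
  odd2 : Odd (Q₂.length - 1)

theorem replace_ears {V : Type*} [DecidableEq V] (G : SimpleGraph V)
    (k : ℕ) (P : Fin (k + 1) → List V) (hdec : IsOddEarDecomp G k P)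
    (i j : Fin (k+1)) (hij : i < j) (hj : (P j).length = 2) (Q₁ Q₂ : List V)
    (H : Replacement (i = 0) (P i) (P j) Q₁ Q₂) :
    ∃ (P' : Fin (k + 1) → List V),
        IsOddEarDecomp G k P' ∧
        (Finset.univ.val.map P' : Multiset (List V)) =
          Finset.univ.val.map P - {P i, P j} + {Q₁, Q₂} ∧
        trivialCount k P' < trivialCount k P := by
  obtain ⟨D, hoddP⟩ := hdec
  obtain ⟨τ, t1, t2, t3, t4⟩ := exists_shift k i j hij
  let R : Fin (k+1) → List V := Function.update (Function.update P i Q₁) j Q₂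
  have Rj : R j = Q₂ := by simp [R]
  have Ri : R i = Q₁ := by simp [R, hij.ne]
  have Rm : ∀ m, m ≠ i → m ≠ j → R m = P m := by intro m h1 h2; simp [R, h1, h2]
  have cases3 : ∀ m : Fin (k+1), m = i ∨ m = j ∨ (m ≠ i ∧ m ≠ j ∧ R m = P m) := by
    intro m
    by_cases h1 : m = i
    · exact Or.inl h1
    · by_cases h2 : m = j
      · exact Or.inr (Or.inl h2)
      · exact Or.inr (Or.inr ⟨h1, h2, Rm m h1 h2⟩)
  have hR : ∀ m, (R ∘ τ.symm) (τ m) = R m := by intro m; simp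
  have hτ0 : ∀ m, 1 ≤ (τ m).1 ↔ 1 ≤ m.1 := by
    intro m
    have : τ m = 0 ↔ m = 0 := by
      rw [← t4, τ.injective.eq_iff, t4]
    rw [Fin.ext_iff, Fin.ext_iff] at this
    simp only [Fin.val_zero] at this
    omega
  have hR0 : (R ∘ τ.symm) 0 = R 0 := by rw [← hR 0, t4]
  have j0 : (0 : Fin (k+1)) ≠ j := by
    intro h; rw [← h] at hij; exact absurd hij (Fin.not_lt_zero i)
  -- later ears see a vertex in the union
  have up : ∀ (m l : Fin (k+1)) (u : V), m ≠ j → l < m → u ∈ P l →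
      ∃ l', τ l' < τ m ∧ u ∈ R l' := by
    intro m l u hm hl hu
    rcases cases3 l with rfl | rfl | ⟨h1, h2, h3⟩
    · rcases (H.verts u).1 hu with h | h
      · exact ⟨l, (t3 _ _ hij.ne hm).2 hl, by rwa [Ri]⟩
      · exact ⟨j, (t2 _ hm).2 hl, by rwa [Rj]⟩
    · exact ⟨i, (t3 _ _ hij.ne hm).2 (hij.trans hl), by rw [Ri]; exact H.sub u hu⟩
    · exact ⟨l, (t3 _ _ h2 hm).2 hl, by rwa [h3]⟩
  have down : ∀ (m l : Fin (k+1)) (u : V), m ≠ j → τ l < τ m → u ∈ R l →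
      ∃ l', l' < m ∧ u ∈ P l' := by
    intro m l u hm hl hu
    rcases cases3 l with rfl | rfl | ⟨h1, h2, h3⟩
    · exact ⟨l, (t3 _ _ hij.ne hm).1 hl, (H.verts u).2 (Or.inl (by rwa [Ri] at hu))⟩
    · exact ⟨i, (t2 _ hm).1 hl, (H.verts u).2 (Or.inr (by rwa [Rj] at hu))⟩
    · exact ⟨l, (t3 _ _ h2 hm).1 hl, by rwa [h3] at hu⟩
  have edgemem : ∀ e, e ∈ listEdges Q₁ ∨ e ∈ listEdges Q₂ ↔
      e ∈ listEdges (P i) ∨ e ∈ listEdges (P j) := by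
    intro e
    have := H.edges.mem_iff (a := e)
    simpa using this
  have nd : (listEdges Q₁ ++ listEdges Q₂).Nodup := by
    rw [H.edges.nodup_iff, List.nodup_append']
    exact ⟨D.edges_nodup i, D.edges_nodup j, fun e he he' =>
      D.edges_disjoint i j hij.ne e he he'⟩
  rw [List.nodup_append'] at nd
  obtain ⟨nd1, nd2, nd3⟩ := nd
  have edgeG : ∀ m, ∀ e ∈ listEdges (P m), e ∈ G.edgeSet := fun m =>
    (chain_iff_edges G _).1 (D.chain m)
  have odd' : ∀ m, Odd ((R m).length - 1) := by
    intro m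
    rcases cases3 m with rfl | rfl | ⟨h1, h2, h3⟩
    · rw [Ri]; exact H.odd1
    · rw [Rj]; exact H.odd2
    · rw [h3]; exact hoddP m
  have hmain : IsEarDecomp G k (R ∘ τ.symm) := by
    refine ⟨?_, ?_, ?_, ?_, ?_, ?_, ?_, ?_, ?_, ?_, ?_, ?_, ?_⟩
    · intro n
      obtain ⟨m, rfl⟩ := τ.surjective n
      rw [hR]
      rcases cases3 m with rfl | rfl | ⟨h1, h2, h3⟩
      · rw [Ri]
        refine (chain_iff_edges G _).2 fun e he => ?_
        rcases (edgemem e).1 (Or.inl he) with h | h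
        · exact edgeG _ _ h
        · exact edgeG _ _ h
      · rw [Rj]
        refine (chain_iff_edges G _).2 fun e he => ?_
        rcases (edgemem e).1 (Or.inr he) with h | h
        · exact edgeG _ _ h
        · exact edgeG _ _ h
      · rw [h3]; exact D.chain m
    · rw [hR0]
      by_cases h : i = 0
      · rw [← h, Ri]; exact (H.circ h).1
      · rw [Rm 0 (Ne.symm h) j0]; exact D.circuit_len
    · rw [hR0]
      by_cases h : i = 0
      · rw [← h, Ri]; exact (H.circ h).2.1
      · rw [Rm 0 (Ne.symm h) j0]; exact D.circuit_closed
    · rw [hR0]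
      by_cases h : i = 0
      · rw [← h, Ri]; exact (H.circ h).2.2
      · rw [Rm 0 (Ne.symm h) j0]; exact D.circuit_nodup
    · intro n
      obtain ⟨m, rfl⟩ := τ.surjective n
      rw [hR, hτ0]
      intro hm
      rcases cases3 m with rfl | rfl | ⟨h1, h2, h3⟩
      · rw [Ri]; have := H.len1; omega
      · rw [Rj]; have := H.len2; omega
      · rw [h3]; exact D.ear_len m hm
    · intro n
      obtain ⟨m, rfl⟩ := τ.surjective n
      rw [hR, hτ0]
      intro hm
      by_cases hmj : m = j
      · obtain ⟨u, hu, hu'⟩ := H.first2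
        exact ⟨u, by rw [hmj, Rj]; exact hu, τ i, by rw [hmj]; exact t1, by rw [hR, Ri]; exact hu'⟩
      · obtain ⟨u, hu, l, hl, hu'⟩ := D.ear_first m hm
        obtain ⟨l', hl', hu''⟩ := up m l u hmj hl hu'
        refine ⟨u, ?_, τ l', hl', by rw [hR]; exact hu''⟩
        rcases cases3 m with rfl | rfl | ⟨h1, h2, h3⟩
        · rw [Ri, (H.ear (by rintro rfl; simp at hm)).1]; exact hu
        · exact absurd rfl hmj
        · rw [h3]; exact hu
    · intro n
      obtain ⟨m, rfl⟩ := τ.surjective n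
      rw [hR, hτ0]
      intro hm
      by_cases hmj : m = j
      · obtain ⟨u, hu, hu'⟩ := H.last2
        exact ⟨u, by rw [hmj, Rj]; exact hu, τ i, by rw [hmj]; exact t1, by rw [hR, Ri]; exact hu'⟩
      · obtain ⟨u, hu, l, hl, hu'⟩ := D.ear_last m hm
        obtain ⟨l', hl', hu''⟩ := up m l u hmj hl hu'
        refine ⟨u, ?_, τ l', hl', by rw [hR]; exact hu''⟩
        rcases cases3 m with rfl | rfl | ⟨h1, h2, h3⟩
        · rw [Ri, (H.ear (by rintro rfl; simp at hm)).2.1]; exact hu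
        · exact absurd rfl hmj
        · rw [h3]; exact hu
    · intro n
      obtain ⟨m, rfl⟩ := τ.surjective n
      rw [hR, hτ0]
      intro hm
      rcases cases3 m with rfl | rfl | ⟨h1, h2, h3⟩
      · rw [Ri]; exact (H.ear (by rintro rfl; simp at hm)).2.2.1
      · rw [Rj]; exact H.nodup2
      · rw [h3]; exact D.ear_internal_nodup m hm
    · intro n
      obtain ⟨m, rfl⟩ := τ.surjective n
      rw [hR, hτ0]
      intro hm v hv n hn
      obtain ⟨l, rfl⟩ := τ.surjective n
      rw [hR]
      intro hvl
      by_cases hmj : m = j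
      · rw [hmj, Rj] at hv
        rw [hmj] at hn
        rcases cases3 l with rfl | rfl | ⟨h1, h2, h3⟩
        · rw [Ri] at hvl; exact H.new2 v hv hvl
        · exact absurd hn (lt_irrefl _)
        · have hli : l < i := by
            rcases lt_trichotomy l i with h | h | h
            · exact h
            · exact absurd h h1
            · exact absurd hn (lt_asymm ((t2 l h2).2 h))
          have hi0 : i ≠ 0 := by rintro rfl; exact absurd hli (Fin.not_lt_zero l)
          rw [h3] at hvl
          refine D.ear_internal_new i ?_ v ((H.ear hi0).2.2.2.2 v hv) l hli hvl
          have : i.1 ≠ 0 := fun h => hi0 (Fin.ext h)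
          omega
      · obtain ⟨l', hl', hvl'⟩ := down m l v hmj hn hvl
        rcases cases3 m with rfl | rfl | ⟨h1, h2, h3⟩
        · rw [Ri] at hv
          exact D.ear_internal_new m hm v
            ((H.ear (by rintro rfl; simp at hm)).2.2.2.1 v hv) l' hl' hvl'
        · exact absurd rfl hmj
        · rw [h3] at hv; exact D.ear_internal_new m hm v hv l' hl' hvl'
    · intro n
      obtain ⟨m, rfl⟩ := τ.surjective n
      rw [hR]
      rcases cases3 m with rfl | rfl | ⟨h1, h2, h3⟩
      · rw [Ri]; exact nd1
      · rw [Rj]; exact nd2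
      · rw [h3]; exact D.edges_nodup m
    · intro n n' hnn e
      obtain ⟨m, rfl⟩ := τ.surjective n
      obtain ⟨l, rfl⟩ := τ.surjective n'
      have hml : m ≠ l := fun h => hnn (by rw [h])
      rw [hR, hR]
      intro he hel
      rcases cases3 m with rfl | rfl | ⟨h1, h2, h3⟩ <;>
        rcases cases3 l with rfl | rfl | ⟨h1', h2', h3'⟩
      · exact hml rfl
      · rw [Ri] at he; rw [Rj] at hel; exact nd3 he hel
      · rw [Ri] at he; rw [h3'] at hel
        rcases (edgemem e).1 (Or.inl he) with h | h
        · exact D.edges_disjoint _ _ hml e h hel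
        · exact D.edges_disjoint _ _ h2' e hel h
      · rw [Rj] at he; rw [Ri] at hel; exact nd3 hel he
      · exact hml rfl
      · rw [Rj] at he; rw [h3'] at hel
        rcases (edgemem e).1 (Or.inr he) with h | h
        · exact D.edges_disjoint _ _ h1' e hel h
        · exact D.edges_disjoint _ _ hml e h hel
      · rw [Ri] at hel; rw [h3] at he
        rcases (edgemem e).1 (Or.inl hel) with h | h
        · exact D.edges_disjoint _ _ hml e he h
        · exact D.edges_disjoint _ _ h2 e he h
      · rw [Rj] at hel; rw [h3] at he
        rcases (edgemem e).1 (Or.inr hel) with h | h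
        · exact D.edges_disjoint _ _ h1 e he h
        · exact D.edges_disjoint _ _ hml e he h
      · rw [h3] at he; rw [h3'] at hel; exact D.edges_disjoint _ _ hml e he hel
    · intro e he
      obtain ⟨l, hl⟩ := D.edges_cover e he
      have key : e ∈ listEdges Q₁ ∨ e ∈ listEdges Q₂ → ∃ n, e ∈ listEdges ((R ∘ τ.symm) n) := by
        rintro (h | h)
        · exact ⟨τ i, by rw [hR, Ri]; exact h⟩
        · exact ⟨τ j, by rw [hR, Rj]; exact h⟩
      rcases cases3 l with rfl | rfl | ⟨h1, h2, h3⟩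
      · exact key ((edgemem e).2 (Or.inl hl))
      · exact key ((edgemem e).2 (Or.inr hl))
      · exact ⟨τ l, by rw [hR, h3]; exact hl⟩
    · intro v
      obtain ⟨l, hl⟩ := D.verts_cover v
      rcases cases3 l with rfl | rfl | ⟨h1, h2, h3⟩
      · rcases (H.verts v).1 hl with h | h
        · exact ⟨τ l, by rw [hR, Ri]; exact h⟩
        · exact ⟨τ j, by rw [hR, Rj]; exact h⟩
      · exact ⟨τ i, by rw [hR, Ri]; exact H.sub v hl⟩
      · exact ⟨τ l, by rw [hR, h3]; exact hl⟩
  -- the multiset of ears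
  have hji : j ∈ Finset.univ.erase i := by simp [hij.ne']
  set S := (Finset.univ.erase i).erase j with hS
  have huniv : (Finset.univ : Finset (Fin (k+1))).val = i ::ₘ j ::ₘ S.val := by
    have e1 : (Finset.univ : Finset (Fin (k+1))) = insert i (insert j S) := by
      rw [hS, Finset.insert_erase hji, Finset.insert_erase (Finset.mem_univ i)]
    rw [e1, Finset.insert_val_of_notMem (by simp [hS, hij.ne]),
      Finset.insert_val_of_notMem (by simp [hS])]
  have m1 : Finset.univ.val.map P = {P i, P j} + S.val.map P := by
    rw [huniv]; simp [Multiset.insert_eq_cons]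
  have m2 : Finset.univ.val.map (R ∘ τ.symm) = S.val.map P + {Q₁, Q₂} := by
    rw [← Multiset.map_map, Multiset.map_univ_val_equiv, huniv]
    rw [add_comm (S.val.map P), Multiset.map_cons, Multiset.map_cons, Ri, Rj]
    have : S.val.map R = S.val.map P := by
      refine Multiset.map_congr rfl fun m hm => ?_
      have : m ∈ S := hm
      simp only [hS, Finset.mem_erase] at this
      exact Rm m this.2.1 this.1
    rw [this]; rfl
  have tc : ∀ T : Fin (k+1) → List V,
      trivialCount k T = (Finset.univ.val.map T).countP (fun l => l.length = 2) := by
    intro T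
    rw [Multiset.countP_map]; rfl
  refine ⟨R ∘ τ.symm, ⟨hmain, fun n => ?_⟩, ?_, ?_⟩
  · obtain ⟨m, rfl⟩ := τ.surjective n
    rw [hR]; exact odd' m
  · rw [m2, m1, add_tsub_cancel_left]
  · rw [tc, tc, m1, m2]
    have h1 : Q₁.length ≠ 2 := by have := H.len1; have h := H.odd1; intro h2; omega
    have h2 : Q₂.length ≠ 2 := by have := H.len2; omega
    have c1 : Multiset.countP (fun l : List V => l.length = 2) {Q₁, Q₂} = 0 := by
      simp [Multiset.insert_eq_cons, ← Multiset.cons_zero, h1, h2]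
    have c2 : 0 < Multiset.countP (fun l : List V => l.length = 2) {P i, P j} :=
      Multiset.countP_pos.2 ⟨P j, by simp, hj⟩
    rw [Multiset.countP_add, Multiset.countP_add, c1]
    omega

theorem edges_pair {V : Type*} {c d : V} {E : List V} (hE : E = [c, d] ∨ E = [d, c]) :
    listEdges E = [s(c, d)] := by
  rcases hE with rfl | rfl
  · rfl
  · rw [Sym2.eq_swap]; rfl

set_option maxHeartbeats 2000000 in
theorem repl_std {V : Type*} (first : Prop) (A M B : List V) (c d x : V) (E : List V)
    (hE : E = [c, d] ∨ E = [d, c])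
    (hnot : s(c, d) ∉ listEdges (A ++ c :: (M ++ d :: (B ++ [x]))))
    (hodd : Odd ((A ++ c :: (M ++ d :: (B ++ [x]))).length - 1))
    (hM : Even M.length)
    (hf : first → (A ++ [c]).head? = some x ∧ (A ++ c :: (M ++ d :: B)).Nodup)
    (he : ¬ first → A ≠ [] ∧ (A.tail ++ c :: (M ++ d :: B)).Nodup ∧
      (∀ v ∈ M, A.head? ≠ some v) ∧ x ∉ M) :
    ∃ Q₁ Q₂, Replacement first (A ++ c :: (M ++ d :: (B ++ [x]))) E Q₁ Q₂ := by
  have hM0 : M ≠ [] := by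
    rintro rfl
    apply hnot
    rw [listEdges_append, List.mem_append]
    right
    simp [listEdges_cons_cons]
  have hMl : 0 < M.length := List.length_pos_iff.2 hM0
  have hA : first ∨ ∃ y A', A = y :: A' := by
    by_cases h : first
    · exact Or.inl h
    · obtain ⟨y, A', h'⟩ := List.exists_cons_of_ne_nil (he h).1
      exact Or.inr ⟨y, A', h'⟩
  have key : M.Nodup ∧ (∀ v ∈ M, v ∉ A ∧ v ≠ c ∧ v ≠ d ∧ v ∉ B ∧ v ≠ x) := by
    by_cases h : first
    · obtain ⟨h1, h2⟩ := hf h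
      have hx : x = c ∨ x ∈ A := by
        cases A with
        | nil => left; simpa using h1.symm
        | cons y A => right; simp at h1; simp [h1]
      simp only [List.nodup_append', List.nodup_cons, List.disjoint_left, List.mem_cons,
        List.mem_append] at h2
      refine ⟨h2.2.1.2.1, fun v hv => ⟨?_, ?_, ?_, ?_, ?_⟩⟩
      · grind
      · grind
      · grind
      · grind
      · grind
    · obtain ⟨h1, h2, h3, h4⟩ := he h
      obtain ⟨y, A', rfl⟩ := List.exists_cons_of_ne_nil h1
      simp only [List.tail_cons, List.nodup_append', List.nodup_cons, List.disjoint_left,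
        List.mem_cons, List.mem_append] at h2
      simp only [List.head?_cons, ne_eq, Option.some.injEq] at h3
      refine ⟨h2.2.1.2.1, fun v hv => ⟨?_, ?_, ?_, ?_, ?_⟩⟩
      · have := h3 v hv
        grind
      · grind
      · grind
      · grind
      · grind
  obtain ⟨key1, key2⟩ := key
  have i2 : listInternal (c :: (M ++ [d])) = M := by simp [listInternal]
  have hl : (A ++ c :: (M ++ d :: (B ++ [x]))).length = A.length + M.length + B.length + 3 := by
    simp; omega
  have hl1 : (A ++ c :: d :: (B ++ [x])).length = A.length + B.length + 3 := by
    simp; omega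
  rw [hl] at hodd
  have o1 : Odd ((A ++ c :: d :: (B ++ [x])).length - 1) := by
    rw [hl1]; grind
  refine ⟨A ++ c :: d :: (B ++ [x]), c :: (M ++ [d]), ?_⟩
  refine ⟨fun h => ⟨?_, ?_, ?_⟩, fun h => ⟨?_, ?_, ?_, ?_, ?_⟩, ?_, ?_, ?_, ?_, ?_, ?_, ?_, ?_,
    ?_, o1, ?_⟩
  · rw [hl1] at o1 ⊢
    grind
  · have h1 := (hf h).1
    have e : A ++ c :: d :: (B ++ [x]) = (A ++ c :: d :: B) ++ [x] := by simp
    rw [e, List.getLast?_concat, ← h1]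
    cases A <;> simp
  · have h2 := (hf h).2
    have e : A ++ c :: d :: (B ++ [x]) = (A ++ c :: d :: B) ++ [x] := by simp
    rw [e, List.dropLast_concat]
    refine h2.sublist ?_
    simp
  · cases A <;> simp
  · have e : A ++ c :: d :: (B ++ [x]) = (A ++ c :: d :: B) ++ [x] := by simp
    have e' : A ++ c :: (M ++ d :: (B ++ [x])) = (A ++ c :: (M ++ d :: B)) ++ [x] := by simp
    rw [e, e', List.getLast?_concat, List.getLast?_concat]
  · obtain ⟨h1, h2, -⟩ := he h
    obtain ⟨y, A', rfl⟩ := List.exists_cons_of_ne_nil h1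
    have e : y :: A' ++ c :: d :: (B ++ [x]) = y :: ((A' ++ c :: d :: B) ++ [x]) := by simp
    rw [e, listInternal, List.tail_cons, List.dropLast_concat]
    refine h2.sublist ?_
    simp
  · obtain ⟨h1, h2, -⟩ := he h
    obtain ⟨y, A', rfl⟩ := List.exists_cons_of_ne_nil h1
    have e : y :: A' ++ c :: d :: (B ++ [x]) = y :: ((A' ++ c :: d :: B) ++ [x]) := by simp
    have e' : y :: A' ++ c :: (M ++ d :: (B ++ [x])) =
      y :: ((A' ++ c :: (M ++ d :: B)) ++ [x]) := by simp
    rw [e, e', listInternal, listInternal, List.tail_cons, List.dropLast_concat, List.tail_cons,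
      List.dropLast_concat]
    intro v
    simp; tauto
  · obtain ⟨h1, h2, -⟩ := he h
    obtain ⟨y, A', rfl⟩ := List.exists_cons_of_ne_nil h1
    have e' : y :: A' ++ c :: (M ++ d :: (B ++ [x])) =
      y :: ((A' ++ c :: (M ++ d :: B)) ++ [x]) := by simp
    rw [i2, e', listInternal, List.tail_cons,
      List.dropLast_concat]
    intro v
    simp; tauto
  · rw [hl1]; omega
  · simp; omega
  · exact ⟨c, rfl, by simp⟩
  · refine ⟨d, ?_, by simp⟩
    rw [← List.cons_append, List.getLast?_concat]
  · rw [i2]; exact key1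
  · rw [i2]
    intro v hv
    have := key2 v hv
    simp; tauto
  · intro v
    simp; tauto
  · rcases hE with rfl | rfl <;> simp
  · rw [edges_pair hE, listEdges_append A c (d :: _), listEdges_append A c (M ++ _),
      listEdges_cons_cons,
      show c :: (M ++ d :: (B ++ [x])) = (c :: M) ++ d :: (B ++ [x]) from rfl,
      show c :: (M ++ [d]) = (c :: M) ++ [d] from rfl,
      listEdges_append (c :: M) d (B ++ [x])]
    rw [← Multiset.coe_eq_coe]
    simp only [← Multiset.coe_add, ← Multiset.cons_coe, ← Multiset.singleton_add,
      Multiset.coe_nil, add_zero]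
    abel
  · simp only [List.length_cons, List.length_append, List.length_nil]
    grind

theorem repl_even {V : Type*} (first : Prop) (A M B : List V) (c d x : V) (E : List V)
    (hE : E = [c, d] ∨ E = [d, c])
    (hnot : s(c, d) ∉ listEdges (A ++ c :: (M ++ d :: (B ++ [x]))))
    (hodd : Odd ((A ++ c :: (M ++ d :: (B ++ [x]))).length - 1))
    (hM : Odd M.length) (f : first)
    (hf : (A ++ [c]).head? = some x) (hn : (A ++ c :: (M ++ d :: B)).Nodup) :
    ∃ Q₁ Q₂, Replacement first (A ++ c :: (M ++ d :: (B ++ [x]))) E Q₁ Q₂ := by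
  have hl : (A ++ c :: (M ++ d :: (B ++ [x]))).length = A.length + M.length + B.length + 3 := by
    simp; omega
  rw [hl] at hodd
  have hAB : 0 < A.length + B.length := by
    by_contra hcon
    have hA0 : A = [] := List.length_eq_zero_iff.1 (by omega)
    have hB0 : B = [] := List.length_eq_zero_iff.1 (by omega)
    subst hA0 hB0
    simp only [List.nil_append, List.head?_cons, Option.some.injEq] at hf
    subst hf
    apply hnot
    rw [List.nil_append, ← List.cons_append, listEdges_append, List.mem_append]
    right
    simp [listEdges_cons_cons, Sym2.eq_swap]
  obtain ⟨A'', hA''⟩ : ∃ A'', A ++ [c] = x :: A'' := by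
    cases A with
    | nil => exact ⟨[], by simpa using hf⟩
    | cons y A => exact ⟨A ++ [c], by simpa using hf⟩
  have i2 : listInternal (d :: (B ++ (A ++ [c]))) = B ++ A := by
    rw [← List.append_assoc, listInternal, List.tail_cons, List.dropLast_concat]
  have hMp : 0 < M.length := hM.pos
  have hx : x = c ∨ x ∈ A := by
    have : x ∈ A ++ [c] := by rw [hA'']; simp
    simp at this; tauto
  simp only [List.nodup_append', List.nodup_cons, List.disjoint_left, List.mem_cons,
        List.mem_append] at hn
  refine ⟨c :: (M ++ [d, c]), d :: (B ++ (A ++ [c])), ?_⟩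
  refine ⟨fun h => ⟨?_, ?_, ?_⟩, fun h => absurd f h, ?_, ?_, ?_, ?_, ?_, ?_, ?_, ?_,
    ?_, ?_, ?_⟩
  · simp; omega
  · have e : c :: (M ++ [d, c]) = c :: (M ++ [d]) ++ [c] := by simp
    rw [e, List.getLast?_concat]; rfl
  · have e : c :: (M ++ [d, c]) = c :: (M ++ [d]) ++ [c] := by simp
    rw [e, List.dropLast_concat]
    simp only [List.nodup_append', List.nodup_cons, List.disjoint_left, List.mem_cons,
        List.mem_append]
    simp
    grind
  · simp
  · simp; omega
  · exact ⟨d, rfl, by simp⟩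
  · refine ⟨c, ?_, by simp⟩
    rw [← List.append_assoc, ← List.cons_append, List.getLast?_concat]
  · rw [i2]
    simp only [List.nodup_append', List.disjoint_left]
    grind
  · rw [i2]
    intro v hv
    simp only [List.mem_append, List.mem_cons, List.not_mem_nil] at hv ⊢
    grind
  · intro v
    simp only [List.mem_append, List.mem_cons, List.not_mem_nil]
    grind
  · rcases hE with rfl | rfl <;> simp
  · have e1 : c :: (M ++ [d, c]) = (c :: M) ++ d :: [c] := rfl
    have e2 : d :: (B ++ (A ++ [c])) = (d :: B) ++ x :: A'' := by rw [hA'']; rfl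
    have e3 : A ++ c :: (M ++ d :: (B ++ [x])) = A ++ c :: (M ++ d :: (B ++ [x])) := rfl
    rw [edges_pair hE, e1, e2, listEdges_append (c :: M) d [c], listEdges_append (d :: B) x A'',
      ← hA'', listEdges_append A c (M ++ _),
      show c :: (M ++ d :: (B ++ [x])) = (c :: M) ++ d :: (B ++ [x]) from rfl,
      listEdges_append (c :: M) d (B ++ [x]), listEdges_cons_cons d c, listEdges_single,
      Sym2.eq_swap (a := d)]
    rw [← Multiset.coe_eq_coe]
    simp only [← Multiset.coe_add, ← Multiset.cons_coe, ← Multiset.singleton_add,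
      Multiset.coe_nil, add_zero, List.cons_append]
    abel
  · simp only [List.length_cons, List.length_append, List.length_nil]
    grind
  · simp only [List.length_cons, List.length_append, List.length_nil]
    grind

theorem repl_ear {V : Type*} (first : Prop) (hfirst : ¬ first) (R E : List V) (c d : V)
    (hE : E = [c, d] ∨ E = [d, c]) (hnot : s(c, d) ∉ listEdges R) (hodd : Odd (R.length - 1))
    (hn : (listInternal R).Nodup)
    (h1 : ∀ v ∈ listInternal R, R.head? ≠ some v)
    (h2 : ∀ v ∈ listInternal R, R.getLast? ≠ some v)
    (p q : ℕ) (hpq : p < q) (hq : q < R.length)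
    (hc : R[p] = c) (hd : R[q] = d) (hp : Odd p) (hq' : Odd (R.length - 1 - q)) :
    ∃ Q₁ Q₂, Replacement first R E Q₁ Q₂ := by
  obtain ⟨A, M, B, hR, lA, lM, lB⟩ := split_at_two R p q hpq hq
  rw [hc, hd] at hR
  have hA : A ≠ [] := by
    rintro rfl; simp at lA; subst lA; simp at hp
  have hB : B ≠ [] := by
    rintro rfl; simp at lB; rw [← lB] at hq'; simp at hq'
  obtain ⟨B', x, rfl⟩ : ∃ B' x, B = B' ++ [x] :=
    ⟨B.dropLast, B.getLast hB, (List.dropLast_append_getLast hB).symm⟩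
  obtain ⟨y, A', rfl⟩ := List.exists_cons_of_ne_nil hA
  have e' : y :: A' ++ c :: (M ++ d :: (B' ++ [x])) =
      y :: ((A' ++ c :: (M ++ d :: B')) ++ [x]) := by simp
  have hIntl : listInternal R = A' ++ c :: (M ++ d :: B') := by
    rw [hR, e', listInternal, List.tail_cons, List.dropLast_concat]
  have hlast : R.getLast? = some x := by
    rw [hR, e', ← List.cons_append, List.getLast?_concat]
  have hhead : R.head? = some y := by rw [hR]; rfl
  rw [hlast, hIntl] at h2
  rw [hhead, hIntl] at h1
  rw [hIntl] at hn
  rw [hR] at hnot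
  have hMe : Even M.length := by
    rw [lM]; grind
  rw [hR] at hodd
  rw [hR]
  refine repl_std first (y :: A') M B' c d x E hE hnot hodd hMe (fun h => absurd h hfirst)
    (fun _ => ⟨hA, hn, fun v hv => h1 v (by simp [hv]), fun hx => h2 x (by simp [hx]) rfl⟩)

theorem repl_circ {V : Type*} (first : Prop) (hfirst : first) (L E : List V) (x c d : V)
    (hE : E = [c, d] ∨ E = [d, c]) (hnot : s(c, d) ∉ listEdges (L ++ [x]))
    (hodd : Odd ((L ++ [x]).length - 1))
    (hn : L.Nodup) (hx : L.head? = some x)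
    (p q : ℕ) (hpq : p < q) (hq : q < L.length)
    (hc : L[p] = c) (hd : L[q] = d) :
    ∃ Q₁ Q₂, Replacement first (L ++ [x]) E Q₁ Q₂ := by
  obtain ⟨A, M, B, hL, -, -, -⟩ := split_at_two L p q hpq hq
  rw [hc, hd] at hL
  have e : L ++ [x] = A ++ c :: (M ++ d :: (B ++ [x])) := by rw [hL]; simp
  rw [e] at hnot hodd ⊢
  have hh : (A ++ [c]).head? = some x := by
    rw [← hx, hL]; cases A <;> simp
  rw [hL] at hn
  rcases Nat.even_or_odd M.length with h | h
  · exact repl_std first A M B c d x E hE hnot hodd h (fun _ => ⟨hh, hn⟩)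
      (fun h => absurd hfirst h)
  · exact repl_even first A M B c d x E hE hnot hodd h hfirst hh hn

end helpers

/-- If in an odd ear-decomposition some odd edge `e = ab` with
`i := ear a = ear b` does not belong to the ear `P i`, then `e` itself forms a
trivial ear `P j` with `j > i`, and replacing the two ears `P i` and `P j = {e}`
by two suitable odd ears yields an odd ear-decomposition of `G` with strictly
fewer trivial ears. -/
theorem stmt_2 {V : Type*} [Fintype V] [DecidableEq V] (G : SimpleGraph V)
    (k : ℕ) (P : Fin (k + 1) → List V) (hdec : IsOddEarDecomp G k P)
    (a b : V) (hab : G.Adj a b) (hodd : IsOddEdge k P a b)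
    (hi : earOf k P a < k + 1)
    (hnot : s(a, b) ∉ listEdges (P ⟨earOf k P a, hi⟩)) :
    ∃ j : Fin (k + 1), earOf k P a < j.1 ∧ (P j = [a, b] ∨ P j = [b, a]) ∧
      ∃ (P' : Fin (k + 1) → List V) (Q₁ Q₂ : List V),
        IsOddEarDecomp G k P' ∧
        Odd (Q₁.length - 1) ∧ Odd (Q₂.length - 1) ∧
        (Finset.univ.val.map P' : Multiset (List V)) =
          Finset.univ.val.map P - {P ⟨earOf k P a, hi⟩, P j} + {Q₁, Q₂} ∧
        trivialCount k P' < trivialCount k P := by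
  have hdec0 := hdec
  obtain ⟨D, hoddP⟩ := hdec
  have ne : ∀ v : V, {i : ℕ | ∃ hi : i < k + 1, v ∈ P ⟨i, hi⟩}.Nonempty := by
    intro v
    obtain ⟨i, hv⟩ := D.verts_cover v
    exact ⟨i.1, i.2, hv⟩
  have hmem : ∀ (v : V) (h : earOf k P v < k + 1), v ∈ P ⟨earOf k P v, h⟩ := by
    intro v h
    obtain ⟨_, h'⟩ := Nat.sInf_mem (ne v)
    exact h'
  have hmin : ∀ (v : V) (l : Fin (k + 1)), v ∈ P l → earOf k P v ≤ l.1 :=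
    fun v l hv => Nat.sInf_le ⟨l.2, hv⟩
  have hea := hmem a hi
  have heb : b ∈ P ⟨earOf k P a, hi⟩ := by
    have h := hmem b (by rw [← hodd.1]; exact hi)
    simpa only [← hodd.1] using h
  have hmina : ∀ l : Fin (k + 1), a ∈ P l → earOf k P a ≤ l.1 := hmin a
  have hminb : ∀ l : Fin (k + 1), b ∈ P l → earOf k P a ≤ l.1 := by
    rw [hodd.1]; exact hmin b
  have hoe := hodd.2
  generalize earOf k P a = i₀ at *
  obtain ⟨j, hj⟩ := D.edges_cover s(a, b) hab
  have hji : j ≠ ⟨i₀, hi⟩ := by rintro rfl; exact hnot hj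
  have hsplit := exists_split_of_mem_edges a b _ hj
  have haj : a ∈ P j := by
    obtain ⟨A, B, h | h⟩ := hsplit <;> rw [h] <;> simp
  have hij : i₀ < j.1 := lt_of_le_of_ne (hmina j haj) fun h => hji (Fin.ext h.symm)
  have hj1 : 1 ≤ j.1 := by omega
  have hna : a ∉ listInternal (P j) := fun h => D.ear_internal_new j hj1 a h ⟨i₀, hi⟩ hij hea
  have hnb : b ∉ listInternal (P j) := fun h => D.ear_internal_new j hj1 b h ⟨i₀, hi⟩ hij heb
  have aux : ∀ (c d : V) (A B : List V), P j = A ++ c :: d :: B → c ∉ listInternal (P j) →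
      d ∉ listInternal (P j) → P j = [c, d] := by
    intro c d A B h hc hd
    rw [h] at hc hd ⊢
    cases A with
    | cons y A => exact absurd (by simp [listInternal]) hc
    | nil =>
      cases B with
      | cons y B => exact absurd (by simp [listInternal]) hd
      | nil => rfl
  have hPj : P j = [a, b] ∨ P j = [b, a] := by
    obtain ⟨A, B, h | h⟩ := hsplit
    · exact Or.inl (aux a b A B h hna hnb)
    · exact Or.inr (aux b a A B h hnb hna)
  refine ⟨j, hij, hPj, ?_⟩
  have hjl : (P j).length = 2 := by rcases hPj with h | h <;> rw [h] <;> rfl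
  have hRep : ∃ Q₁ Q₂, Replacement ((⟨i₀, hi⟩ : Fin (k + 1)) = 0) (P ⟨i₀, hi⟩) (P j) Q₁ Q₂ := by
    have hnot' : s(b, a) ∉ listEdges (P ⟨i₀, hi⟩) := by rw [Sym2.eq_swap]; exact hnot
    by_cases h0 : i₀ = 0
    · subst h0
      have z : (⟨0, hi⟩ : Fin (k + 1)) = 0 := rfl
      rw [z] at hnot hnot' hea heb ⊢
      have hlen := D.circuit_len
      have hcl := D.circuit_closed
      have hnd := D.circuit_nodup
      have hod := hoddP 0
      obtain ⟨L, x, hL⟩ : ∃ L x, P 0 = L ++ [x] := by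
        have : P 0 ≠ [] := by intro h; rw [h] at hlen; simp at hlen
        exact ⟨_, _, (List.dropLast_append_getLast this).symm⟩
      rw [hL] at hlen hcl hnd hod hnot hnot' hea heb ⊢
      rw [List.dropLast_concat] at hnd
      rw [List.getLast?_concat] at hcl
      have hx : L.head? = some x := by
        cases L with
        | nil => simp at hlen
        | cons y L => simpa using hcl
      have hxL : x ∈ L := List.mem_of_mem_head? hx
      have haL : a ∈ L := by
        rcases List.mem_append.1 hea with h | h
        · exact h
        · rw [List.mem_singleton.1 h]; exact hxL
      have hbL : b ∈ L := by
        rcases List.mem_append.1 heb with h | h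
        · exact h
        · rw [List.mem_singleton.1 h]; exact hxL
      obtain ⟨p, hp, hpa⟩ := List.getElem_of_mem haL
      obtain ⟨q, hq, hqb⟩ := List.getElem_of_mem hbL
      rcases lt_trichotomy p q with h | h | h
      · exact repl_circ _ rfl L (P j) x a b hPj hnot hod hnd hx p q h hq hpa hqb
      · subst h; exact absurd (hpa.symm.trans hqb) hab.ne
      · exact repl_circ _ rfl L (P j) x b a hPj.symm hnot' hod hnd hx q p h hp hqb hpa
    · have hi1 : 1 ≤ i₀ := by omega
      have hf : ¬ ((⟨i₀, hi⟩ : Fin (k + 1)) = 0) := by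
        intro h; exact h0 (congrArg Fin.val h)
      have h1 : ∀ v ∈ listInternal (P ⟨i₀, hi⟩), (P ⟨i₀, hi⟩).head? ≠ some v := by
        intro v hv h
        obtain ⟨u, hu, l, hl, hul⟩ := D.ear_first ⟨i₀, hi⟩ hi1
        rw [h] at hu
        cases hu
        exact D.ear_internal_new _ hi1 v hv l hl hul
      have h2 : ∀ v ∈ listInternal (P ⟨i₀, hi⟩), (P ⟨i₀, hi⟩).getLast? ≠ some v := by
        intro v hv h
        obtain ⟨u, hu, l, hl, hul⟩ := D.ear_last ⟨i₀, hi⟩ hi1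
        rw [h] at hu
        cases hu
        exact D.ear_internal_new _ hi1 v hv l hl hul
      obtain ⟨_, p, q, hpa, hqb, c1, c2⟩ := hoe hi1
      have hnd := D.ear_internal_nodup ⟨i₀, hi⟩ hi1
      rcases lt_trichotomy p.1 q.1 with h | h | h
      · refine repl_ear _ hf _ (P j) a b hPj hnot (hoddP _) hnd h1 h2 p.1 q.1 h q.2 hpa hqb ?_ ?_
        · rcases c1 with c | c
          · exact c.2
          · omega
        · rcases c2 with c | c
          · omega
          · exact c.2
      · omega
      · refine repl_ear _ hf _ (P j) b a hPj.symm hnot' (hoddP _) hnd h1 h2 q.1 p.1 h p.2 hqb hpa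
          ?_ ?_
        · rcases c2 with c | c
          · exact c.2
          · omega
        · rcases c1 with c | c
          · omega
          · exact c.2
  obtain ⟨Q₁, Q₂, H⟩ := hRep
  obtain ⟨P', g1, g2, g3⟩ := replace_ears G k P hdec0 ⟨i₀, hi⟩ j hij hjl Q₁ Q₂ H
  exact ⟨P', Q₁, Q₂, g1, H.odd1, H.odd2, g2, g3⟩
end
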